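/- arXiv:1705.08724 — 4 statements merged into one kernel-verified Lean document; each statement's English description precedes it below -/
import Mathlib

section
/- A minimum counterexample to Hajós' conjecture is biconnected, i.e., it is 2-connected (connected, has at least 3 vertices, and remains connected after the deletion of any single vertex). -/
/-- A simple graph is Eulerian if it is connected and every vertex has even degree. -/
def IsEulerian {V : Type} [Fintype V] (G : SimpleGraph V) : Prop :=
  G.Connected ∧ ∀ v : V, Even ((G.neighborSet v).ncard)

/-- `G` fulfils Hajós' conjecture: its edge set can be partitioned into at most
`⌊(n-1)/2⌋` edge-disjoint cycles, where `n` is the number of vertices. -/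
def FulfilsHajos {V : Type} [Fintype V] (G : SimpleGraph V) : Prop :=
  ∃ (m : ℕ) (B : Fin m → V) (c : (i : Fin m) → G.Walk (B i) (B i)),
    m ≤ (Fintype.card V - 1) / 2 ∧
    (∀ i, (c i).IsCycle) ∧
    (∀ i j, i ≠ j → ∀ e, e ∈ (c i).edges → e ∉ (c j).edges) ∧
    (∀ e, e ∈ G.edgeSet ↔ ∃ i, e ∈ (c i).edges)

/-- A counterexample to Hajós' conjecture is an Eulerian graph not fulfilling it. -/
def IsCounterexample {V : Type} [Fintype V] (G : SimpleGraph V) : Prop :=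
  IsEulerian G ∧ ¬ FulfilsHajos G

/-- A minimum counterexample: a counterexample with the minimum number of edges among
all counterexamples having the minimum number of vertices. -/
def IsMinCounterexample {V : Type} [Fintype V] (G : SimpleGraph V) : Prop :=
  IsCounterexample G ∧
  (∀ (W : Type) [Fintype W] (H : SimpleGraph W),
      IsCounterexample H → Fintype.card V ≤ Fintype.card W) ∧
  (∀ (W : Type) [Fintype W] (H : SimpleGraph W),
      IsCounterexample H → Fintype.card W = Fintype.card V →
      G.edgeSet.ncard ≤ H.edgeSet.ncard)

open SimpleGraph

/-- A cycle decomposition may be indexed by any finite type of small enough cardinality. -/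
theorem FulfilsHajos.of_fintype {V : Type} [Fintype V] {G : SimpleGraph V} {ι : Type*} [Fintype ι]
    (b : ι → V) (c : (i : ι) → G.Walk (b i) (b i))
    (hcard : Fintype.card ι ≤ (Fintype.card V - 1) / 2)
    (hcycle : ∀ i, (c i).IsCycle)
    (hdisj : ∀ i j, i ≠ j → ∀ e, e ∈ (c i).edges → e ∉ (c j).edges)
    (hcover : ∀ e, e ∈ G.edgeSet ↔ ∃ i, e ∈ (c i).edges) : FulfilsHajos G := by
  let f := (Fintype.equivFin ι).symm
  refine ⟨Fintype.card ι, fun i => b (f i), fun i => c (f i), hcard, fun i => hcycle _,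
    fun i j hij => hdisj _ _ (f.injective.ne hij), fun e => ?_⟩
  rw [hcover, f.surjective.exists]

/-- The vertices of `A` other than `v` have all their neighbours in `A`, which contains `v`. -/
structure IsBlockUnion {V : Type} (G : SimpleGraph V) (v : V) (A : Set V) : Prop where
  mem : v ∈ A
  closed : ∀ x ∈ A, x ≠ v → ∀ y, G.Adj x y → y ∈ A

namespace IsBlockUnion

variable {V : Type} {G : SimpleGraph V} {v : V} {A : Set V}

theorem insert_compl (h : IsBlockUnion G v A) : IsBlockUnion G v (insert v Aᶜ) where
  mem := Set.mem_insert _ _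
  closed x hx hxv y hxy := by
    by_contra hy
    simp only [Set.mem_insert_iff, Set.mem_compl_iff, not_or, not_not] at hx hy
    exact (hx.resolve_left hxv) (h.closed y hy.2 hy.1 x hxy.symm)

theorem reachable_induce (h : IsBlockUnion G v A) {x : V} (p : G.Walk x v) (hx : x ∈ A) :
    (G.induce A).Reachable ⟨x, hx⟩ ⟨v, h.mem⟩ := by
  induction p with
  | nil => exact Reachable.refl _
  | @cons x y v hxy p ih =>
    by_cases hxv : x = v
    · subst hxv
      exact Reachable.refl _
    · have hy := h.closed x hx hxv y hxy
      have hadj : (G.induce A).Adj ⟨x, hx⟩ ⟨y, hy⟩ := hxy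
      exact hadj.reachable.trans (ih h hy)

theorem connected_induce (h : IsBlockUnion G v A) (hG : G.Connected) :
    (G.induce A).Connected := by
  have : Nonempty A := ⟨⟨v, h.mem⟩⟩
  have key (x : A) : (G.induce A).Reachable x ⟨v, h.mem⟩ :=
    (hG.preconnected x v).elim fun p => h.reachable_induce p x.2
  exact ⟨fun x y => (key x).trans (key y).symm⟩

theorem ncard_neighborSet_induce (h : IsBlockUnion G v A) (x : A) (hx : (x : V) ≠ v) :
    ((G.induce A).neighborSet x).ncard = (G.neighborSet x).ncard := by
  rw [← Set.ncard_image_of_injective _ Subtype.val_injective]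
  congr 1
  ext y
  constructor
  · rintro ⟨z, hz, rfl⟩
    exact hz
  · intro hy
    exact ⟨⟨y, h.closed x x.2 hx y hy⟩, hy, rfl⟩

open Classical in
theorem isEulerian_induce [Fintype V] [Fintype A] (h : IsBlockUnion G v A) (hG : IsEulerian G) :
    IsEulerian (G.induce A) := by
  refine ⟨h.connected_induce hG.1, ?_⟩
  have hdeg (x : A) : ((G.induce A).neighborSet x).ncard = (G.induce A).degree x := by
    rw [Set.ncard_eq_toFinset_card', ← card_neighborFinset_eq_degree]
    rfl
  have hne (x : A) (hx : (x : V) ≠ v) : Even ((G.induce A).neighborSet x).ncard := by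
    rw [h.ncard_neighborSet_induce x hx]
    exact hG.2 x
  intro x
  by_contra hx
  rw [hdeg, Nat.not_even_iff_odd] at hx
  obtain ⟨y, hyx, hy⟩ := (G.induce A).exists_ne_odd_degree_of_exists_odd_degree x hx
  have eq_v (z : A) (hz : Odd ((G.induce A).degree z)) : (z : V) = v := by
    by_contra hzv
    exact Nat.not_even_iff_odd.2 (hdeg z ▸ hz) (hne z hzv)
  exact hyx (Subtype.ext ((eq_v y hy).trans (eq_v x hx).symm))

theorem card_add_card [Fintype V] [Fintype A] [Fintype (insert v Aᶜ : Set V)]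
    (h : IsBlockUnion G v A) :
    Fintype.card A + Fintype.card (insert v Aᶜ : Set V) = Fintype.card V + 1 := by
  have hv : v ∉ Aᶜ := fun hv => hv h.mem
  simp only [← Nat.card_eq_fintype_card, Nat.card_coe_set_eq]
  rw [Set.ncard_insert_of_notMem hv, ← add_assoc, Set.ncard_add_ncard_compl]

theorem fulfilsHajos [Fintype V] [Fintype A] [Fintype (insert v Aᶜ : Set V)]
    (h : IsBlockUnion G v A) (hA : FulfilsHajos (G.induce A))
    (hB : FulfilsHajos (G.induce (insert v Aᶜ))) : FulfilsHajos G := by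
  obtain ⟨m, b, c, hm, hcycle, hdisj, hcover⟩ := hA
  obtain ⟨m', b', c', hm', hcycle', hdisj', hcover'⟩ := hB
  have hcard := h.card_add_card
  have hposA : 0 < Fintype.card A := Fintype.card_pos_iff.2 ⟨⟨v, h.mem⟩⟩
  have hposB : 0 < Fintype.card (insert v Aᶜ : Set V) :=
    Fintype.card_pos_iff.2 ⟨⟨v, h.insert_compl.mem⟩⟩
  have mem_edges {S : Set V} {x : S} (p : (G.induce S).Walk x x) (e : Sym2 V) :
      e ∈ (p.map (Embedding.induce S).toHom).edges ↔
        ∃ e' ∈ p.edges, e'.map Subtype.val = e := by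
    rw [Walk.edges_map, List.mem_map]
    rfl
  have mem_of_edges {S : Set V} {x : S} (p : (G.induce S).Walk x x) (y z : V)
      (he : s(y, z) ∈ (p.map (Embedding.induce S).toHom).edges) : y ∈ S ∧ z ∈ S := by
    obtain ⟨e', -, he'⟩ := (mem_edges p _).1 he
    have hS (w : V) (hw : w ∈ e'.map Subtype.val) : w ∈ S := by
      obtain ⟨a, -, rfl⟩ := Sym2.mem_map.1 hw
      exact a.2
    rw [he'] at hS
    exact ⟨hS y (Sym2.mem_mk_left _ _), hS z (Sym2.mem_mk_right _ _)⟩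
  have disj {S : Set V} {x y : S} (p : (G.induce S).Walk x x) (q : (G.induce S).Walk y y)
      (hpq : ∀ e, e ∈ p.edges → e ∉ q.edges) (e : Sym2 V)
      (hp : e ∈ (p.map (Embedding.induce S).toHom).edges) :
      e ∉ (q.map (Embedding.induce S).toHom).edges := by
    intro hq
    obtain ⟨e₁, h₁, rfl⟩ := (mem_edges p _).1 hp
    obtain ⟨e₂, h₂, heq⟩ := (mem_edges q _).1 hq
    rw [Sym2.map.injective Subtype.val_injective heq] at h₂
    exact hpq e₁ h₁ h₂
  have disjAB {x : A} {y : (insert v Aᶜ : Set V)} (p : (G.induce A).Walk x x)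
      (q : (G.induce (insert v Aᶜ)).Walk y y) (e : Sym2 V)
      (hp : e ∈ (p.map (Embedding.induce A).toHom).edges) :
      e ∉ (q.map (Embedding.induce (insert v Aᶜ)).toHom).edges := by
    intro hq
    induction e with | _ a b
    have hab := (Walk.edges_subset_edgeSet _ hp : G.Adj a b)
    obtain ⟨ha, hb⟩ := mem_of_edges p a b hp
    obtain ⟨ha', hb'⟩ := mem_of_edges q a b hq
    have hav : a = v := ha'.resolve_right fun hn => hn ha
    have hbv : b = v := hb'.resolve_right fun hn => hn hb
    exact hab.ne (hav.trans hbv.symm)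
  refine FulfilsHajos.of_fintype (ι := Fin m ⊕ Fin m') (Sum.elim (fun i => b i) fun i => b' i)
    (fun i => match i with
      | .inl i => (c i).map (Embedding.induce A).toHom
      | .inr i => (c' i).map (Embedding.induce (insert v Aᶜ)).toHom) ?_ ?_ ?_ ?_
  · simp only [Fintype.card_sum, Fintype.card_fin]
    lia
  · rintro (i | i)
    · exact (hcycle i).map Subtype.val_injective
    · exact (hcycle' i).map Subtype.val_injective
  · rintro (i | i) (j | j) hij e he
    · exact disj _ _ (hdisj i j fun hn => hij (congrArg _ hn)) e he
    · exact disjAB _ _ e he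
    · exact fun hj => disjAB _ _ e hj he
    · exact disj _ _ (hdisj' i j fun hn => hij (congrArg _ hn)) e he
  · intro e
    constructor
    · intro he
      induction e with | _ x y
      have hxy : G.Adj x y := he
      have hsides : (x ∈ A ∧ y ∈ A) ∨
          (x ∈ (insert v Aᶜ : Set V) ∧ y ∈ (insert v Aᶜ : Set V)) := by
        have h1 := h.closed x
        have h2 := h.closed y
        have h3 := hxy.symm
        have h4 := h.mem
        simp only [Set.mem_insert_iff, Set.mem_compl_iff]
        grind
      rcases hsides with ⟨hx, hy⟩ | ⟨hx, hy⟩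
      · obtain ⟨i, hi⟩ := (hcover s(⟨x, hx⟩, ⟨y, hy⟩)).1 hxy
        exact ⟨.inl i, (mem_edges _ _).2 ⟨_, hi, rfl⟩⟩
      · obtain ⟨i, hi⟩ := (hcover' s(⟨x, hx⟩, ⟨y, hy⟩)).1 hxy
        exact ⟨.inr i, (mem_edges _ _).2 ⟨_, hi, rfl⟩⟩
    · rintro ⟨i, hi⟩
      exact Walk.edges_subset_edgeSet _ hi

end IsBlockUnion

/-- The component of `x` in `G - v`, together with `v`. -/
theorem isBlockUnion_component {V : Type} (G : SimpleGraph V) (v : V) (x : ({v}ᶜ : Set V)) :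
    IsBlockUnion G v
      {z | ∀ hz : z ∈ ({v}ᶜ : Set V), (G.induce {v}ᶜ).Reachable x ⟨z, hz⟩} where
  mem hv := absurd rfl hv
  closed a ha hav b hab hb := by
    have hadj : (G.induce {v}ᶜ).Adj ⟨a, hav⟩ ⟨b, hb⟩ := hab
    exact (ha hav).trans hadj.reachable

theorem IsCounterexample.three_le_card {V : Type} [Fintype V] {G : SimpleGraph V}
    (hG : IsCounterexample G) : 3 ≤ Fintype.card V := by
  obtain ⟨⟨-, heven⟩, hnot⟩ := hG
  have hbot : G ≠ ⊥ := by
    rintro rfl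
    exact hnot ⟨0, Fin.elim0, fun i => i.elim0, Nat.zero_le _, fun i => i.elim0,
      fun i => i.elim0, by simp⟩
  obtain ⟨x, y, hxy⟩ := ne_bot_iff_exists_adj.1 hbot
  have hpos : 0 < (G.neighborSet x).ncard := (Set.ncard_pos).2 ⟨y, hxy⟩
  have hlt : (G.neighborSet x).ncard < Fintype.card V := by
    rw [← Nat.card_eq_fintype_card]
    exact Set.ncard_lt_card (fun hn => G.irrefl (hn ▸ Set.mem_univ x : x ∈ G.neighborSet x))
  obtain ⟨k, hk⟩ := heven x
  lia

/-- A minimum counterexample to Hajós' conjecture is biconnected: it is connected,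
has at least 3 vertices, and remains connected after deleting any single vertex. -/
theorem minCounterexample_biconnected {V : Type} [Fintype V] (G : SimpleGraph V)
    (hG : IsMinCounterexample G) :
    G.Connected ∧ 3 ≤ Fintype.card V ∧
      ∀ v : V, (G.induce ({v}ᶜ : Set V)).Connected := by
  classical
  obtain ⟨hcount, hmin, -⟩ := hG
  have hthree := hcount.three_le_card
  refine ⟨hcount.1.1, hthree, fun v => ?_⟩
  have : Nonempty ({v}ᶜ : Set V) := by
    have : Nontrivial V := Fintype.one_lt_card_iff_nontrivial.1 (by lia)
    obtain ⟨w, hw⟩ := exists_ne v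
    exact ⟨⟨w, hw⟩⟩
  refine ⟨fun x y => ?_⟩
  by_contra hxy
  have h := isBlockUnion_component G v x
  set A : Set V := {z | ∀ hz : z ∈ ({v}ᶜ : Set V), (G.induce {v}ᶜ).Reachable x ⟨z, hz⟩}
  have hxA : (x : V) ∈ A := fun _ => Reachable.refl _
  have hyA : (y : V) ∉ A := fun hy => hxy (hy y.2)
  have small {S : Set V} [Fintype S] (hS : IsBlockUnion G v S) {w : V} (hw : w ∉ S) :
      FulfilsHajos (G.induce S) := by
    by_contra hn
    have hle := hmin S (G.induce S) ⟨hS.isEulerian_induce hcount.1, hn⟩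
    exact hle.not_gt (Fintype.card_subtype_lt hw)
  refine hcount.2 (h.fulfilsHajos (small h hyA) (small h.insert_compl (w := x) ?_))
  rintro (hx | hx)
  · exact x.2 hx
  · exact hx hxA
end

section
/- In a minimum counterexample G to Hajós' conjecture, the two neighbours of any vertex of degree 2 are adjacent to each other. -/
namespace SimpleGraph

variable {V : Type} {G : SimpleGraph V} {v : V} {a b : {x // x ≠ v}}

/-- The graph obtained from `G` by deleting the vertex `v` and adding the edge `ab`. -/
def suppress (G : SimpleGraph V) (v : V) (a b : {x // x ≠ v}) : SimpleGraph {x // x ≠ v} :=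
  G.comap Subtype.val ⊔ edge a b

lemma suppress_adj (hab : a ≠ b) {x y : {x // x ≠ v}} :
    (G.suppress v a b).Adj x y ↔ G.Adj x y ∨ x = a ∧ y = b ∨ x = b ∧ y = a := by
  simp only [suppress, sup_adj, comap_adj, edge_adj]
  grind

lemma suppress_comm (G : SimpleGraph V) (a b : {x // x ≠ v}) :
    G.suppress v a b = G.suppress v b a := by
  simp [suppress, edge_comm]

lemma suppress_connected (hG : G.Connected) (hab : a ≠ b)
    (hN : ∀ x, G.Adj v x ↔ x = a ∨ x = b) : (G.suppress v a b).Connected := by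
  classical
  have hab' : (G.suppress v a b).Reachable a b := Adj.reachable (by simp [suppress_adj hab])
  let f : V → {x // x ≠ v} := fun x => if h : x = v then a else ⟨x, h⟩
  have hf (x : {x // x ≠ v}) : f x = x := by simp [f, x.2]
  have hfv : f v = a := by simp [f]
  have hN' (x : V) (h : G.Adj v x) : (G.suppress v a b).Reachable a (f x) := by
    rcases (hN x).1 h with rfl | rfl <;> rw [hf]
    exact hab'
  have hadj (x y : V) (h : G.Adj x y) : (G.suppress v a b).Reachable (f x) (f y) := by
    by_cases hx : x = v
    · subst hx
      exact hfv ▸ hN' y h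
    by_cases hy : y = v
    · subst hy
      exact hfv ▸ (hN' x h.symm).symm
    · refine Adj.reachable ((suppress_adj hab).2 (Or.inl ?_))
      simpa [f, hx, hy] using h
  have hwalk {x y : V} (p : G.Walk x y) : (G.suppress v a b).Reachable (f x) (f y) := by
    induction p with
    | nil => rfl
    | cons h _ ih => exact (hadj _ _ h).trans ih
  have : Nonempty {x // x ≠ v} := ⟨a⟩
  refine ⟨fun x y => ?_⟩
  obtain ⟨p⟩ := hG.preconnected x y
  simpa [hf] using hwalk p

lemma ncard_neighborSet_suppress_left [Finite V] (hab : a ≠ b) (hva : G.Adj v a)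
    (hnadj : ¬ G.Adj a b) :
    ((G.suppress v a b).neighborSet a).ncard = (G.neighborSet a).ncard := by
  rw [← Set.ncard_image_of_injective _ Subtype.val_injective]
  have himage : Subtype.val '' (G.suppress v a b).neighborSet a =
      insert b.1 (G.neighborSet a \ {v}) := by
    ext x
    simp only [Set.mem_image, mem_neighborSet, suppress_adj hab, Set.mem_insert_iff,
      Set.mem_sdiff, Set.mem_singleton_iff]
    constructor
    · rintro ⟨y, h, rfl⟩
      have := y.2
      grind
    · rintro (rfl | ⟨h, hx⟩)
      · exact ⟨b, by simp, rfl⟩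
      · exact ⟨⟨x, hx⟩, Or.inl h, rfl⟩
  rw [himage, Set.ncard_insert_of_notMem (fun h => hnadj h.1)]
  exact Set.ncard_sdiff_singleton_add_one hva.symm

lemma ncard_neighborSet_suppress [Finite V] (hab : a ≠ b)
    (hN : ∀ x, G.Adj v x ↔ x = a ∨ x = b) (hnadj : ¬ G.Adj a b) (x : {x // x ≠ v}) :
    ((G.suppress v a b).neighborSet x).ncard = (G.neighborSet x).ncard := by
  by_cases hxa : x = a
  · subst hxa
    exact ncard_neighborSet_suppress_left hab ((hN _).2 (Or.inl rfl)) hnadj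
  by_cases hxb : x = b
  · subst hxb
    rw [suppress_comm]
    exact ncard_neighborSet_suppress_left hab.symm ((hN _).2 (Or.inr rfl))
      fun h => hnadj h.symm
  rw [← Set.ncard_image_of_injective _ Subtype.val_injective]
  congr 1
  ext y
  simp only [Set.mem_image, mem_neighborSet, suppress_adj hab, hxa, hxb, false_and, or_false]
  constructor
  · rintro ⟨z, h, rfl⟩
    exact h
  · intro h
    refine ⟨⟨y, ?_⟩, h, rfl⟩
    rintro rfl
    rcases (hN x).1 h.symm with h | h
    · exact hxa (Subtype.ext h)
    · exact hxb (Subtype.ext h)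

/-- A walk of `G.suppress v a b` avoiding the edge `ab` lifts to a walk of `G`. -/
lemma exists_lift_of_notMem_edges (hab : a ≠ b) {x y : {x // x ≠ v}}
    (p : (G.suppress v a b).Walk x y) (hp : s(a, b) ∉ p.edges) :
    ∃ q : G.Walk x y, q.support = p.support.map Subtype.val ∧
      q.edges = p.edges.map (Sym2.map Subtype.val) := by
  induction p with
  | nil => exact ⟨.nil, by simp, by simp⟩
  | @cons x y z h p ih =>
    simp only [Walk.edges_cons, List.mem_cons, not_or] at hp
    obtain ⟨q, hs, he⟩ := ih hp.2
    have hG : G.Adj x y := by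
      rcases (suppress_adj hab).1 h with h | ⟨rfl, rfl⟩ | ⟨rfl, rfl⟩
      · exact h
      · exact absurd rfl hp.1
      · exact absurd Sym2.eq_swap hp.1
    exact ⟨.cons hG q, by simp [hs], by simp [he]⟩

/-- A cycle through the edge `uw` consists of that edge and a path from `w` to `u`. -/
lemma Walk.IsCycle.exists_isPath_of_mem_edges {W : Type} {H : SimpleGraph W} {x u w : W}
    {c : H.Walk x x} (hc : c.IsCycle) (he : s(u, w) ∈ c.edges) :
    ∃ p : H.Walk w u, p.IsPath ∧ s(u, w) ∉ p.edges ∧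
      ∀ e, e ∈ c.edges ↔ e = s(u, w) ∨ e ∈ p.edges := by
  classical
  have hsnd {d : H.Walk u u} (hd : d.IsCycle) (hw : w = d.snd) :
      ∃ p : H.Walk w u, p.IsPath ∧ s(u, w) ∉ p.edges ∧
        ∀ e, e ∈ d.edges ↔ e = s(u, w) ∨ e ∈ p.edges := by
    cases d with
    | nil => exact absurd rfl hd.ne_nil
    | cons h p =>
      rw [Walk.snd_cons] at hw
      subst hw
      obtain ⟨hp, he⟩ := (Walk.cons_isCycle_iff p h).1 hd
      exact ⟨p, hp, he, by simp⟩
  have hends {d : H.Walk u u} (hd : d.IsCycle) (he : s(u, w) ∈ d.edges) :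
      w = d.snd ∨ w = d.reverse.snd := by
    cases d with
    | nil => exact absurd rfl hd.ne_nil
    | cons h p =>
      rw [Walk.edges_cons, List.mem_cons, Sym2.congr_right] at he
      refine he.imp (fun h => by simpa using h) fun hwp => ?_
      have hp : ¬ p.Nil := fun hp => by simp [Walk.edges_eq_nil.2 hp] at hwp
      rw [Walk.snd_reverse, Walk.penultimate_cons_of_not_nil _ _ hp]
      exact ((Walk.cons_isCycle_iff p h).1 hd).1.eq_penultimate_of_mem_edges hwp
  have hu := c.fst_mem_support_of_mem_edges he
  have hd : (c.rotate u hu).IsCycle := hc.rotate hu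
  have hmem (e) : e ∈ (c.rotate u hu).edges ↔ e ∈ c.edges := (c.rotate_edges u hu).mem_iff
  simp only [← hmem]
  rcases hends hd ((hmem _).2 he) with hw | hw
  · exact hsnd hd hw
  · simpa using hsnd hd.reverse hw

/-- The edges of `G` replacing an edge set of `G.suppress v a b`: the edge `ab` is
subdivided into `va` and `vb`, and every other edge is kept. -/
def subdividedEdges (a b : {x // x ≠ v}) (E : Set (Sym2 {x // x ≠ v})) : Set (Sym2 V) :=
  {e | (∃ e' ∈ E, e' ≠ s(a, b) ∧ e'.map Subtype.val = e) ∨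
    s(a, b) ∈ E ∧ (e = s(v, a.1) ∨ e = s(v, b.1))}

lemma notMem_map_val (e : Sym2 {x // x ≠ v}) : v ∉ e.map Subtype.val := by
  rw [Sym2.mem_map]
  rintro ⟨x, -, hx⟩
  exact x.2 hx

lemma disjoint_subdividedEdges {E F : Set (Sym2 {x // x ≠ v})} (h : Disjoint E F) :
    Disjoint (subdividedEdges a b E) (subdividedEdges a b F) := by
  rw [Set.disjoint_left] at h ⊢
  rintro e (⟨e₁, h₁, -, rfl⟩ | ⟨h₁, h₁'⟩) (⟨e₂, h₂, -, h₂'⟩ | ⟨h₂, h₂'⟩)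
  · exact h h₁ (Sym2.map.injective Subtype.val_injective h₂' ▸ h₂)
  · have := notMem_map_val e₁
    rcases h₂' with h₂' | h₂' <;> simp [h₂'] at this
  · subst h₂'
    have := notMem_map_val e₂
    rcases h₁' with h₁' | h₁' <;> simp [h₁'] at this
  · exact h h₁ h₂

lemma subdividedEdges_iUnion {ι : Sort*} (E : ι → Set (Sym2 {x // x ≠ v})) :
    subdividedEdges a b (⋃ i, E i) = ⋃ i, subdividedEdges a b (E i) := by
  ext e
  simp only [subdividedEdges, Set.mem_iUnion, Set.mem_ofPred_eq]
  grind

lemma subdividedEdges_edgeSet_suppress (hab : a ≠ b) (hN : ∀ x, G.Adj v x ↔ x = a ∨ x = b)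
    (hnadj : ¬ G.Adj a b) :
    subdividedEdges a b (G.suppress v a b).edgeSet = G.edgeSet := by
  have hmem : s(a, b) ∈ (G.suppress v a b).edgeSet := by simp [suppress_adj hab]
  ext e
  constructor
  · rintro (⟨e', h, hne, rfl⟩ | ⟨-, rfl | rfl⟩)
    · induction e' with | _ x y =>
      rcases (suppress_adj hab).1 h with h | ⟨rfl, rfl⟩ | ⟨rfl, rfl⟩
      · exact h
      · exact absurd rfl hne
      · exact absurd Sym2.eq_swap hne
    · exact (hN _).2 (Or.inl rfl)
    · exact (hN _).2 (Or.inr rfl)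
  · induction e with | _ x y =>
    intro h
    rw [mem_edgeSet] at h
    by_cases hx : x = v
    · subst hx
      rcases (hN y).1 h with rfl | rfl
      · exact Or.inr ⟨hmem, Or.inl rfl⟩
      · exact Or.inr ⟨hmem, Or.inr rfl⟩
    by_cases hy : y = v
    · subst hy
      rw [Sym2.eq_swap]
      rcases (hN x).1 h.symm with rfl | rfl
      · exact Or.inr ⟨hmem, Or.inl rfl⟩
      · exact Or.inr ⟨hmem, Or.inr rfl⟩
    refine Or.inl ⟨s(⟨x, hx⟩, ⟨y, hy⟩), (suppress_adj hab).2 (Or.inl h), ?_, rfl⟩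
    intro heq
    rcases Sym2.eq_iff.1 heq with ⟨rfl, rfl⟩ | ⟨rfl, rfl⟩
    · exact hnadj h
    · exact hnadj h.symm

/-- A cycle of `G.suppress v a b` gives a cycle of `G` by subdividing the edge `ab`. -/
lemma exists_isCycle_subdividedEdges (hab : a ≠ b) (hva : G.Adj v a) (hvb : G.Adj v b)
    {x : {x // x ≠ v}} {c : (G.suppress v a b).Walk x x} (hc : c.IsCycle) :
    ∃ (y : V) (d : G.Walk y y), d.IsCycle ∧
      {e | e ∈ d.edges} = subdividedEdges a b {e | e ∈ c.edges} := by
  by_cases he : s(a, b) ∈ c.edges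
  · obtain ⟨p, hp, hpe, hpc⟩ := hc.exists_isPath_of_mem_edges he
    obtain ⟨q, hqs, hqe⟩ := exists_lift_of_notMem_edges hab p hpe
    have hq : q.IsPath := by
      rw [Walk.isPath_def, hqs]
      exact hp.support_nodup.map Subtype.val_injective
    have hv : v ∉ q.support := by simp [hqs]
    refine ⟨a, .cons hva.symm (.cons hvb q), ?_, ?_⟩
    · rw [Walk.cons_isCycle_iff]
      refine ⟨hq.cons hv, ?_⟩
      rw [Walk.edges_cons, List.mem_cons, not_or]
      refine ⟨?_, fun h => hv (Walk.snd_mem_support_of_mem_edges _ h)⟩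
      rw [Sym2.eq_swap, Sym2.congr_right]
      exact fun h => hab (Subtype.ext h)
    · ext e
      simp only [subdividedEdges, Set.mem_ofPred_eq, Walk.edges_cons, List.mem_cons, hqe,
        List.mem_map, hpc, Sym2.eq_swap (a := a.1) (b := v)]
      grind
  · obtain ⟨d, hds, hde⟩ := exists_lift_of_notMem_edges hab c he
    refine ⟨x, d, ?_, ?_⟩
    · rw [Walk.isCycle_def, Walk.isTrail_def, hde, hds, ← List.map_tail]
      refine ⟨hc.edges_nodup.map (Sym2.map.injective Subtype.val_injective), ?_,
        hc.support_nodup.map Subtype.val_injective⟩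
      intro hnil
      exact hc.ne_nil (Walk.edges_eq_nil.1 (by simpa [hnil] using hde.symm)).eq_nil
    · ext e
      simp only [subdividedEdges, Set.mem_ofPred_eq, hde, List.mem_map]
      grind

end SimpleGraph

open SimpleGraph

lemma fulfilsHajos_of_suppress {V : Type} [Fintype V] {G : SimpleGraph V} {v : V}
    [Fintype {x // x ≠ v}] {a b : {x // x ≠ v}} (hab : a ≠ b)
    (hN : ∀ x, G.Adj v x ↔ x = a ∨ x = b) (hnadj : ¬ G.Adj a b)
    (h : FulfilsHajos (G.suppress v a b)) : FulfilsHajos G := by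
  obtain ⟨m, B, c, hm, hc, hdisj, hcover⟩ := h
  choose B' d hd hde using fun i =>
    exists_isCycle_subdividedEdges hab ((hN _).2 (Or.inl rfl)) ((hN _).2 (Or.inr rfl)) (hc i)
  refine ⟨m, B', d, ?_, hd, fun i j hij e hi hj => ?_, fun e => ?_⟩
  · have : Fintype.card {x // x ≠ v} ≤ Fintype.card V := Fintype.card_subtype_le _
    omega
  · have hdisj' : Disjoint {e | e ∈ (c i).edges} {e | e ∈ (c j).edges} :=
      Set.disjoint_left.2 (hdisj i j hij)
    have := disjoint_subdividedEdges (a := a) (b := b) hdisj'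
    rw [← hde, ← hde] at this
    exact Set.disjoint_left.1 this hi hj
  · have hE : (G.suppress v a b).edgeSet = ⋃ i, {e | e ∈ (c i).edges} := by
      ext e
      simpa using hcover e
    rw [← subdividedEdges_edgeSet_suppress hab hN hnadj, hE, subdividedEdges_iUnion]
    simp only [← hde, Set.mem_iUnion, Set.mem_ofPred_eq]

/-- In a minimum counterexample, the two neighbours of any degree-2 vertex are adjacent. -/
theorem minCounterexample_deg_two_neighbours_adjacent {V : Type} [Fintype V]
    (G : SimpleGraph V) (hG : IsMinCounterexample G)
    (v : V) (hv : (G.neighborSet v).ncard = 2)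
    (a b : V) (ha : G.Adj v a) (hb : G.Adj v b) (hab : a ≠ b) :
    G.Adj a b := by
  classical
  by_contra hnadj
  have hset : {a, b} = G.neighborSet v :=
    Set.eq_of_subset_of_ncard_le (by simp [Set.insert_subset_iff, ha, hb])
      (by rw [hv, Set.ncard_pair hab])
  have hN (x : V) : G.Adj v x ↔ x = a ∨ x = b := by
    rw [← mem_neighborSet, ← hset]
    rfl
  obtain ⟨⟨⟨hconn, heven⟩, hnot⟩, hmin, -⟩ := hG
  let a' : {x // x ≠ v} := ⟨a, ha.ne'⟩
  let b' : {x // x ≠ v} := ⟨b, hb.ne'⟩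
  have hab' : a' ≠ b' := fun h => hab (congrArg Subtype.val h)
  have hcounter : IsCounterexample (G.suppress v a' b') := by
    refine ⟨⟨suppress_connected hconn hab' hN, fun x => ?_⟩,
      fun h => hnot (fulfilsHajos_of_suppress hab' hN hnadj h)⟩
    rw [ncard_neighborSet_suppress hab' hN hnadj]
    exact heven x
  exact (hmin _ _ hcounter).not_gt (Fintype.card_subtype_lt (x := v) (by simp))
end

section
/- In a minimum counterexample G to Hajós' conjecture, for every vertex v of degree 4, the subgraph of G induced by the neighbourhood N(v) is a regular graph (all vertices of the induced subgraph have the same degree). -/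
open SimpleGraph

/-- A set of edges is a circuit if it is the edge set of a cycle (in the complete graph). -/
def IsCircuit {V : Type} (S : Set (Sym2 V)) : Prop :=
  ∃ (u : V) (c : (⊤ : SimpleGraph V).Walk u u), c.IsCycle ∧ S = {e | e ∈ c.edges}

/-- The family `S` partitions the edge set `E` into circuits. -/
structure IsCircuitPartition {V ι : Type} (E : Set (Sym2 V)) (S : ι → Set (Sym2 V)) : Prop where
  circuit : ∀ i, IsCircuit (S i)
  disjoint : ∀ i j, i ≠ j → ∀ e, e ∈ S i → e ∉ S j
  mem_iff : ∀ e, e ∈ E ↔ ∃ i, e ∈ S i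

/-- The edge set `E` can be partitioned into at most `k` circuits. -/
def HasCircuitPartition {V : Type} (E : Set (Sym2 V)) (k : ℕ) : Prop :=
  ∃ (ι : Type) (_ : Fintype ι) (S : ι → Set (Sym2 V)),
    Fintype.card ι ≤ k ∧ IsCircuitPartition E S

theorem fulfilsHajos_iff {V : Type} [Fintype V] (G : SimpleGraph V) :
    FulfilsHajos G ↔ HasCircuitPartition G.edgeSet ((Fintype.card V - 1) / 2) := by
  constructor
  · rintro ⟨m, B, c, hm, hc, hd, he⟩
    refine ⟨Fin m, inferInstance, fun i => {e | e ∈ (c i).edges}, by simpa using hm, ?_, hd, he⟩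
    intro i
    exact ⟨B i, (c i).mapLe le_top, (hc i).mapLe le_top, by simp⟩
  · rintro ⟨ι, _, S, hm, hS⟩
    choose B c hc hSc using hS.circuit
    have hsub : ∀ i, ∀ e ∈ (c i).edges, e ∈ G.edgeSet := by
      intro i e he
      refine (hS.mem_iff e).2 ⟨i, ?_⟩
      rw [hSc i]
      exact he
    let f := (Fintype.equivFin ι).symm
    refine ⟨Fintype.card ι, fun i => B (f i), fun i => (c (f i)).transfer G (hsub (f i)), hm,
      fun i => (hc _).transfer _, ?_, ?_⟩
    · intro i j hij e
      have := hS.disjoint (f i) (f j) (fun h => hij (f.injective h)) e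
      rw [hSc, hSc] at this
      simpa using this
    · intro e
      rw [hS.mem_iff, ← f.exists_congr_right]
      simp [hSc]

theorem IsCircuit.exists_path {V : Type} {S : Set (Sym2 V)} (hS : IsCircuit S) {a b : V}
    (hab : s(a, b) ∈ S) :
    ∃ p : (⊤ : SimpleGraph V).Walk b a, p.IsPath ∧ s(a, b) ∉ p.edges ∧ a ≠ b ∧
      S = {e | e = s(a, b) ∨ e ∈ p.edges} := by
  classical
  obtain ⟨u, c, hc, rfl⟩ := hS
  have hab' : s(a, b) ∈ c.edges := hab
  have hne : a ≠ b := (c.adj_of_mem_edges hab').ne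
  have ha : a ∈ c.support := c.fst_mem_support_of_mem_edges hab'
  have key : ∀ d : (⊤ : SimpleGraph V).Walk a a, d.IsCycle → (∀ e, e ∈ d.edges ↔ e ∈ c.edges) →
      d.snd = b → ∃ p : (⊤ : SimpleGraph V).Walk b a, p.IsPath ∧ s(a, b) ∉ p.edges ∧ a ≠ b ∧
      {e | e ∈ c.edges} = {e | e = s(a, b) ∨ e ∈ p.edges} := by
    intro d hd hdc hsnd
    cases d with
    | nil => exact absurd hd Walk.not_isCycle_nil
    | cons h p =>
      simp only [Walk.snd_cons] at hsnd
      subst hsnd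
      rw [Walk.cons_isCycle_iff] at hd
      refine ⟨p, hd.1, hd.2, hne, ?_⟩
      ext e
      simp [← hdc]
  have hr := hc.rotate ha
  have hmem : ∀ e, e ∈ (c.rotate a ha).edges ↔ e ∈ c.edges :=
    fun e => (c.rotate_edges a ha).mem_iff
  generalize c.rotate a ha = d at hr hmem
  have hd : s(a, b) ∈ d.edges := (hmem _).2 hab'
  cases d with
  | nil => simp at hd
  | cons h p =>
    rw [Walk.edges_cons, List.mem_cons] at hd
    rcases hd with hd | hd
    · refine key _ hr hmem ?_
      rw [Walk.snd_cons]
      simp only [Sym2.eq_iff] at hd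
      grind
    · refine key _ hr.reverse (fun e => by rw [Walk.edges_reverse, List.mem_reverse, hmem]) ?_
      rw [Walk.snd_reverse, Walk.penultimate_cons_of_not_nil]
      · exact (((Walk.cons_isCycle_iff _ _).1 hr).1.eq_penultimate_of_mem_edges hd).symm
      · intro hnil
        rw [Walk.edges_eq_nil.2 hnil] at hd
        simp at hd

theorem SimpleGraph.Walk.IsPath.exists_eq_cons_of_mem_edges {V : Type} {G : SimpleGraph V}
    {v a b : V} {p : G.Walk v a} (hp : p.IsPath) (hb : s(v, b) ∈ p.edges) :
    ∃ (h : G.Adj v b) (q : G.Walk b a), p = Walk.cons h q := by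
  cases p with
  | nil => simp at hb
  | cons h q =>
    rename_i w
    rw [Walk.cons_isPath_iff] at hp
    rw [Walk.edges_cons, List.mem_cons] at hb
    rcases hb with hb | hb
    · have : b = w := by
        simp only [Sym2.eq_iff] at hb
        grind
      subst this
      exact ⟨h, q, rfl⟩
    · exact absurd (q.fst_mem_support_of_mem_edges hb) hp.2

theorem IsCircuit.exists_path_of_mem_of_mem {V : Type} {S : Set (Sym2 V)} (hS : IsCircuit S)
    {a v b : V} (hab : a ≠ b) (ha : s(a, v) ∈ S) (hb : s(v, b) ∈ S) :
    ∃ q : (⊤ : SimpleGraph V).Walk b a, q.IsPath ∧ v ∉ q.support ∧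
      S = {e | e = s(a, v) ∨ e = s(v, b) ∨ e ∈ q.edges} := by
  obtain ⟨p, hp, hap, hav, rfl⟩ := hS.exists_path ha
  have hb' : s(v, b) ∈ p.edges := by
    rcases hb with hb | hb
    · simp only [Sym2.eq_iff] at hb
      grind
    · exact hb
  obtain ⟨h, q, rfl⟩ := hp.exists_eq_cons_of_mem_edges hb'
  rw [Walk.cons_isPath_iff] at hp
  refine ⟨q, hp.1, hp.2, ?_⟩
  ext e
  simp

theorem IsCircuit.subdivide {V : Type} {S : Set (Sym2 V)} (hS : IsCircuit S) {a b v : V}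
    (hab : s(a, b) ∈ S) (hv : ∀ e ∈ S, v ∉ e) :
    IsCircuit {e | (e ∈ S ∧ e ≠ s(a, b)) ∨ e = s(a, v) ∨ e = s(v, b)} := by
  obtain ⟨p, hp, hap, hne, rfl⟩ := hS.exists_path hab
  have hva : v ≠ a := fun h => hv _ hab (by simp [h])
  have hvb : v ≠ b := fun h => hv _ hab (by simp [h])
  have hvp : v ∉ p.support := by
    intro h
    rw [Walk.mem_support_iff_exists_mem_edges] at h
    rcases h with h | ⟨e, he, hve⟩
    · exact hva h
    · exact hv e (Or.inr he) hve
  refine ⟨a, Walk.cons (show (⊤ : SimpleGraph V).Adj a v from hva.symm)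
    (Walk.cons (show (⊤ : SimpleGraph V).Adj v b from hvb) p), ?_, ?_⟩
  · rw [Walk.cons_isCycle_iff, Walk.cons_isPath_iff]
    refine ⟨⟨hp, hvp⟩, ?_⟩
    rw [Walk.edges_cons, List.mem_cons]
    rintro (h | h)
    · simp only [Sym2.eq_iff] at h
      grind
    · exact hvp (p.snd_mem_support_of_mem_edges h)
  · ext e
    simp only [Set.mem_ofPred_eq, Walk.edges_cons, List.mem_cons]
    have : e ∈ p.edges → e ≠ s(a, b) := fun h h' => hap (h' ▸ h)
    tauto

theorem IsCircuit.shortcut {V : Type} {S : Set (Sym2 V)} (hS : IsCircuit S) {a v b : V}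
    (hab : a ≠ b) (ha : s(a, v) ∈ S) (hb : s(v, b) ∈ S) (hn : s(a, b) ∉ S) :
    IsCircuit {e | (e ∈ S ∧ e ≠ s(a, v) ∧ e ≠ s(v, b)) ∨ e = s(a, b)} := by
  obtain ⟨q, hq, hv, rfl⟩ := hS.exists_path_of_mem_of_mem hab ha hb
  refine ⟨a, Walk.cons (show (⊤ : SimpleGraph V).Adj a b from hab) q, ?_, ?_⟩
  · rw [Walk.cons_isCycle_iff]
    exact ⟨hq, fun h => hn (Or.inr (Or.inr h))⟩
  · ext e
    simp only [Set.mem_ofPred_eq, Walk.edges_cons, List.mem_cons]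
    have h1 : e ∈ q.edges → e ≠ s(a, v) := by
      rintro h rfl
      exact hv (q.snd_mem_support_of_mem_edges h)
    have h2 : e ∈ q.edges → e ≠ s(v, b) := by
      rintro h rfl
      exact hv (q.fst_mem_support_of_mem_edges h)
    tauto

theorem IsCircuit.eq_triangle {V : Type} {S : Set (Sym2 V)} (hS : IsCircuit S) {a v b : V}
    (hab : a ≠ b) (ha : s(a, v) ∈ S) (hb : s(v, b) ∈ S) (h : s(a, b) ∈ S) {e : Sym2 V}
    (he : e ∈ S) : e = s(a, v) ∨ e = s(v, b) ∨ e = s(a, b) := by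
  obtain ⟨q, hq, hv, rfl⟩ := hS.exists_path_of_mem_of_mem hab ha hb
  have h' : s(b, a) ∈ q.edges := by
    rw [Sym2.eq_swap]
    rcases h with h | h | h
    · have : v = b := by
        simp only [Sym2.eq_iff] at h
        grind
      exact absurd (this ▸ q.start_mem_support) hv
    · have : v = a := by
        simp only [Sym2.eq_iff] at h
        grind
      exact absurd (this ▸ q.end_mem_support) hv
    · exact h
  obtain ⟨h1, r, rfl⟩ := hq.exists_eq_cons_of_mem_edges h'
  rw [Walk.cons_isPath_iff, Walk.isPath_iff_nil] at hq
  rcases he with he | he | he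
  · exact Or.inl he
  · exact Or.inr (Or.inl he)
  · rw [Walk.edges_cons, Walk.edges_eq_nil.2 hq.1, List.mem_singleton, Sym2.eq_swap] at he
    exact Or.inr (Or.inr he)

theorem IsCircuit.exists_two_of_mem {V : Type} {S : Set (Sym2 V)} (hS : IsCircuit S) {v : V}
    {e : Sym2 V} (he : e ∈ S) (hv : v ∈ e) :
    ∃ a b, a ≠ b ∧ s(a, v) ∈ S ∧ s(v, b) ∈ S := by
  obtain ⟨b, rfl⟩ := Sym2.mem_iff_exists.1 hv
  obtain ⟨p, hp, hvp, hne, rfl⟩ := hS.exists_path he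
  have hmem := Walk.mk_penultimate_end_mem_edges (Walk.not_nil_of_ne (p := p) hne.symm)
  refine ⟨p.penultimate, b, ?_, Or.inr hmem, Or.inl rfl⟩
  intro h
  rw [h, Sym2.eq_swap] at hmem
  exact hvp hmem

theorem IsCircuit.map {V W : Type} {S : Set (Sym2 V)} (hS : IsCircuit S) {f : V → W}
    (hf : Function.Injective f) : IsCircuit (Sym2.map f '' S) := by
  obtain ⟨u, c, hc, rfl⟩ := hS
  let g : (⊤ : SimpleGraph V) →g (⊤ : SimpleGraph W) :=
    ⟨f, fun {a b} (h : a ≠ b) => hf.ne h⟩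
  refine ⟨f u, c.map g, hc.map hf, ?_⟩
  ext e
  simp [g]

theorem IsCircuitPartition.update {V ι : Type} [DecidableEq ι] {E E' : Set (Sym2 V)}
    {S : ι → Set (Sym2 V)} (hS : IsCircuitPartition E S) {i : ι} {T : Set (Sym2 V)}
    (hT : IsCircuit T) (hTE : ∀ e ∈ T, e ∈ S i ∨ e ∉ E)
    (hE' : ∀ e, e ∈ E' ↔ (e ∈ E ∧ e ∉ S i) ∨ e ∈ T) :
    IsCircuitPartition E' (Function.update S i T) := by
  obtain ⟨hc, hd, hm⟩ := hS
  refine ⟨fun j => ?_, fun j l hjl e => ?_, fun e => ?_⟩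
  · by_cases h : j = i
    · subst h
      simpa using hT
    · simpa [h] using hc j
  · have := hTE e
    have := hm e
    simp only [Function.update_apply]
    grind
  · rw [hE']
    constructor
    · rintro (⟨h, h'⟩ | h)
      · obtain ⟨j, hj⟩ := (hm e).1 h
        refine ⟨j, ?_⟩
        rwa [Function.update_of_ne]
        rintro rfl
        exact h' hj
      · exact ⟨i, by simpa using h⟩
    · rintro ⟨j, hj⟩
      by_cases h : j = i
      · subst h
        exact Or.inr (by simpa using hj)
      · rw [Function.update_of_ne h] at hj
        exact Or.inl ⟨(hm e).2 ⟨j, hj⟩, hd j i h e hj⟩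

theorem IsCircuitPartition.update_two {V ι : Type} [DecidableEq ι] {E : Set (Sym2 V)}
    {S : ι → Set (Sym2 V)} (hS : IsCircuitPartition E S) {i j : ι} (hij : i ≠ j)
    {T U : Set (Sym2 V)} (hT : IsCircuit T) (hU : IsCircuit U) (hTU : ∀ e ∈ T, e ∉ U)
    (hunion : ∀ e, e ∈ T ∨ e ∈ U ↔ e ∈ S i ∨ e ∈ S j) :
    IsCircuitPartition E (Function.update (Function.update S i T) j U) := by
  obtain ⟨hc, hd, hm⟩ := hS
  refine ⟨fun l => ?_, fun l m hlm e => ?_, fun e => ?_⟩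
  · simp only [Function.update_apply]
    split_ifs
    exacts [hU, hT, hc l]
  · have := hTU e
    have := hunion e
    have := hd l m hlm e
    have := hd l i
    have := hd l j
    have := hd i m
    have := hd j m
    simp only [Function.update_apply]
    grind
  · have := hunion e
    rw [hm]
    constructor
    · rintro ⟨l, hl⟩
      by_cases h : l = i ∨ l = j
      · have : e ∈ T ∨ e ∈ U := by grind
        rcases this with h' | h'
        · exact ⟨i, by simpa [hij] using h'⟩
        · exact ⟨j, by simpa using h'⟩
      · push Not at h
        exact ⟨l, by simpa [h.1, h.2] using hl⟩
    · rintro ⟨l, hl⟩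
      simp only [Function.update_apply] at hl
      grind

theorem HasCircuitPartition.subdivide {V : Type} {E : Set (Sym2 V)} {k : ℕ}
    (hE : HasCircuitPartition E k) {v a b x y : V} (hab : a ≠ b)
    (hv : ∀ e ∈ E, v ∈ e → e = s(a, v) ∨ e = s(v, b)) (habE : s(a, b) ∈ E)
    (hxyE : s(x, y) ∈ E) (hva : v ≠ a) (hvb : v ≠ b)
    (hax : a ≠ x) (hay : a ≠ y) (hbx : b ≠ x) (hby : b ≠ y) :
    HasCircuitPartition {e | (e ∈ E ∧ e ≠ s(x, y)) ∨ e = s(x, v) ∨ e = s(v, y)} k := by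
  classical
  obtain ⟨ι, _, S, hk, hS⟩ := hE
  have hxvE : s(x, v) ∉ E := by
    intro h
    have := hv _ h (by simp)
    simp only [Sym2.eq_iff] at this
    grind
  have hvyE : s(v, y) ∉ E := by
    intro h
    have := hv _ h (by simp)
    simp only [Sym2.eq_iff] at this
    grind
  have avoiding : ∀ (S : ι → Set (Sym2 V)) (i : ι), IsCircuitPartition E S → s(x, y) ∈ S i →
      (∀ e ∈ S i, v ∉ e) →
      HasCircuitPartition {e | (e ∈ E ∧ e ≠ s(x, y)) ∨ e = s(x, v) ∨ e = s(v, y)} k := by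
    intro S i hS hi hvi
    refine ⟨ι, inferInstance, _, hk,
      hS.update (i := i) ((hS.circuit i).subdivide hi hvi) ?_ ?_⟩
    · rintro e (h | rfl | rfl)
      exacts [Or.inl h.1, Or.inr hxvE, Or.inr hvyE]
    · intro e
      have := (hS.mem_iff e).2
      simp only [Set.mem_ofPred_eq]
      grind
  obtain ⟨i, hi⟩ := (hS.mem_iff _).1 hxyE
  by_cases hvi : ∀ e ∈ S i, v ∉ e
  · exact avoiding S i hS hi hvi
  push Not at hvi
  obtain ⟨e, he, hve⟩ := hvi
  have hav : s(a, v) ∈ S i ∧ s(v, b) ∈ S i := by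
    obtain ⟨c, d, hcd, hc, hd⟩ := (hS.circuit i).exists_two_of_mem he hve
    have h1 := hv _ ((hS.mem_iff _).2 ⟨i, hc⟩) (by simp)
    have h2 := hv _ ((hS.mem_iff _).2 ⟨i, hd⟩) (by simp)
    rcases h1 with h1 | h1 <;> rcases h2 with h2 | h2
    · simp only [Sym2.eq_iff] at h1 h2
      grind
    · exact ⟨h1 ▸ hc, h2 ▸ hd⟩
    · exact ⟨h2 ▸ hd, h1 ▸ hc⟩
    · simp only [Sym2.eq_iff] at h1 h2
      grind
  have hxy1 : s(x, y) ≠ s(a, v) := by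
    simp only [ne_eq, Sym2.eq_iff]
    grind
  have hxy2 : s(x, y) ≠ s(v, b) := by
    simp only [ne_eq, Sym2.eq_iff]
    grind
  have hxy3 : s(x, y) ≠ s(a, b) := by
    simp only [ne_eq, Sym2.eq_iff]
    grind
  have habi : s(a, b) ∉ S i := by
    intro h
    have := (hS.circuit i).eq_triangle hab hav.1 hav.2 h hi
    tauto
  obtain ⟨j, hj⟩ := (hS.mem_iff _).1 habE
  have hij : i ≠ j := by
    rintro rfl
    exact habi hj
  have hvj : ∀ e ∈ S j, v ∉ e := by
    intro e he hve
    rcases hv e ((hS.mem_iff _).2 ⟨j, he⟩) hve with rfl | rfl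
    · exact hS.disjoint i j hij _ hav.1 he
    · exact hS.disjoint i j hij _ hav.2 he
  have hne1 : s(a, b) ≠ s(a, v) := fun h => habi (h ▸ hav.1)
  have hne2 : s(a, b) ≠ s(v, b) := fun h => habi (h ▸ hav.2)
  refine avoiding _ i (hS.update_two hij ((hS.circuit i).shortcut hab hav.1 hav.2 habi)
    ((hS.circuit j).subdivide hj hvj) ?_ ?_) ?_ ?_
  · intro e
    have := hS.disjoint i j hij e
    simp only [Set.mem_ofPred_eq]
    grind
  · intro e
    simp only [Set.mem_ofPred_eq]
    grind
  · simp only [Function.update_of_ne hij, Function.update_self]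
    exact Or.inl ⟨hi, hxy1, hxy2⟩
  · simp only [Function.update_of_ne hij, Function.update_self]
    rintro e (⟨he, h1, h2⟩ | rfl) hve
    · have := hv e ((hS.mem_iff _).2 ⟨i, he⟩) hve
      tauto
    · simp [hva, hvb] at hve

theorem HasCircuitPartition.of_induce {W : Type} {H : SimpleGraph W} {A : Set W} {k l : ℕ}
    (hA : ∀ x y, H.Adj x y → (x ∈ A ↔ y ∈ A))
    (hk : HasCircuitPartition (H.induce A).edgeSet k)
    (hl : HasCircuitPartition (H.induce Aᶜ).edgeSet l) :
    HasCircuitPartition H.edgeSet (k + l) := by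
  obtain ⟨ι, _, S, hι, hS⟩ := hk
  obtain ⟨κ, _, T, hκ, hT⟩ := hl
  have hinj : ∀ B : Set W, Function.Injective (Sym2.map (Subtype.val : B → W)) :=
    fun B => Sym2.map.injective Subtype.val_injective
  have hne : ∀ (e : Sym2 A) (f : Sym2 (Aᶜ : Set W)),
      Sym2.map Subtype.val e ≠ Sym2.map Subtype.val f := by
    intro e f
    induction e with | _ a b
    induction f with | _ c d
    have := a.2
    have := b.2
    have := c.2
    have := d.2
    simp only [Sym2.map_mk, ne_eq, Sym2.eq_iff]
    grind
  refine ⟨ι ⊕ κ, inferInstance, Sum.elim (fun i => Sym2.map Subtype.val '' S i)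
    (fun i => Sym2.map Subtype.val '' T i), by simpa using Nat.add_le_add hι hκ, ?_, ?_, ?_⟩
  · rintro (i | i)
    · exact (hS.circuit i).map Subtype.val_injective
    · exact (hT.circuit i).map Subtype.val_injective
  · rintro (i | i) (j | j) hij _ ⟨e, he, rfl⟩ ⟨f, hf, hef⟩
    · obtain rfl := hinj _ hef
      exact hS.disjoint i j (fun h => hij (h ▸ rfl)) _ he hf
    · exact hne _ _ hef.symm
    · exact hne _ _ hef
    · obtain rfl := hinj _ hef
      exact hT.disjoint i j (fun h => hij (h ▸ rfl)) _ he hf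
  · intro e
    constructor
    · induction e with | _ x y
      intro h
      by_cases hx : x ∈ A
      · have hy := (hA x y h).1 hx
        obtain ⟨i, hi⟩ := (hS.mem_iff s(⟨x, hx⟩, ⟨y, hy⟩)).1 h
        exact ⟨Sum.inl i, _, hi, rfl⟩
      · have hy : y ∉ A := fun hy => hx ((hA x y h).2 hy)
        obtain ⟨i, hi⟩ := (hT.mem_iff s(⟨x, hx⟩, ⟨y, hy⟩)).1 h
        exact ⟨Sum.inr i, _, hi, rfl⟩
    · rintro ⟨i | i, f, hf, rfl⟩
      · have := (hS.mem_iff f).2 ⟨i, hf⟩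
        induction f with | _ x y
        exact this
      · have := (hT.mem_iff f).2 ⟨i, hf⟩
        induction f with | _ x y
        exact this

theorem SimpleGraph.ncard_neighborSet_induce {W : Type} {H : SimpleGraph W} {A : Set W}
    (hA : ∀ x y, H.Adj x y → (x ∈ A ↔ y ∈ A)) (x : A) :
    ((H.induce A).neighborSet x).ncard = (H.neighborSet x).ncard := by
  rw [← Set.ncard_image_of_injective _ Subtype.val_injective]
  congr 1
  ext y
  constructor
  · rintro ⟨z, hz, rfl⟩
    exact hz
  · intro h
    exact ⟨⟨y, (hA x y h).1 x.2⟩, h, rfl⟩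

theorem IsMinCounterexample.hasCircuitPartition {V : Type} [Fintype V] {G : SimpleGraph V}
    (hG : IsMinCounterexample G) (n : ℕ) :
    ∀ (W : Type) [Fintype W] [Nonempty W] (H : SimpleGraph W), Fintype.card W = n →
      (∀ w, Even (H.neighborSet w).ncard) →
      (n < Fintype.card V ∨ n = Fintype.card V ∧ H.edgeSet.ncard < G.edgeSet.ncard) →
      HasCircuitPartition H.edgeSet ((n - 1) / 2) := by
  classical
  induction n using Nat.strong_induction_on with
  | _ n ih =>
  intro W _ _ H hn heven hlt
  by_cases hconn : H.Connected
  · rw [← hn, ← fulfilsHajos_iff]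
    by_contra hnot
    have hc : IsCounterexample H := ⟨⟨hconn, heven⟩, hnot⟩
    rcases hlt with h | ⟨h, h'⟩
    · have := hG.2.1 W H hc
      omega
    · have := hG.2.2 W H hc (hn.trans h)
      omega
  · have hpre : ¬ H.Preconnected := fun h => hconn ⟨h⟩
    simp only [SimpleGraph.Preconnected, not_forall] at hpre
    obtain ⟨x, y, hxy⟩ := hpre
    let A : Set W := {z | H.Reachable x z}
    have hA : ∀ z w, H.Adj z w → (z ∈ A ↔ w ∈ A) := fun z w h =>
      ⟨fun hz => Reachable.trans hz h.reachable, fun hw => Reachable.trans hw h.symm.reachable⟩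
    have hA' : ∀ z w, H.Adj z w → (z ∈ Aᶜ ↔ w ∈ Aᶜ) := fun z w h => not_congr (hA z w h)
    have hx : x ∈ A := Reachable.refl x
    have hy : y ∈ Aᶜ := hxy
    have : Nonempty A := ⟨⟨x, hx⟩⟩
    have : Nonempty (Aᶜ : Set W) := ⟨⟨y, hy⟩⟩
    have hcard : Fintype.card A + Fintype.card (Aᶜ : Set W) = n := by
      rw [Fintype.card_compl_set, hn]
      have := Fintype.card_subtype_le (fun z => z ∈ A)
      have : Fintype.card A ≤ n := hn ▸ this
      omega
    have h1 : 0 < Fintype.card A := Fintype.card_pos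
    have h2 : 0 < Fintype.card (Aᶜ : Set W) := Fintype.card_pos
    have p1 := ih (Fintype.card A) (by omega) A (H.induce A) rfl
      (fun w => by rw [ncard_neighborSet_induce hA]; exact heven w) (by omega)
    have p2 := ih (Fintype.card (Aᶜ : Set W)) (by omega) (Aᶜ : Set W) (H.induce Aᶜ) rfl
      (fun w => by rw [ncard_neighborSet_induce hA']; exact heven w) (by omega)
    obtain ⟨ι, _, S, hι, hS⟩ := HasCircuitPartition.of_induce hA p1 p2
    exact ⟨ι, inferInstance, S, by omega, hS⟩

/-- If a vertex `v` of even-degree graph `G` has exactly the four neighbours `a`, `b`, `x`, `y`,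
replacing the path `x v y` by a new edge `x y` keeps all degrees even. -/
theorem SimpleGraph.even_ncard_neighborSet_of_split {V : Type} [Fintype V] {G H : SimpleGraph V}
    {v a b x y : V} (heven : ∀ w, Even (G.neighborSet w).ncard)
    (hN : G.neighborSet v = {a, b, x, y}) (hab : a ≠ b) (hax : a ≠ x) (hay : a ≠ y)
    (hbx : b ≠ x) (hby : b ≠ y) (hxy : x ≠ y) (hxyG : ¬ G.Adj x y)
    (hH : ∀ c d, H.Adj c d ↔
      (G.Adj c d ∧ s(c, d) ≠ s(x, v) ∧ s(c, d) ≠ s(v, y)) ∨ s(c, d) = s(x, y)) (w : V) :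
    Even (H.neighborSet w).ncard := by
  have hadj : ∀ z, G.Adj v z ↔ z = a ∨ z = b ∨ z = x ∨ z = y := fun z => by
    rw [← mem_neighborSet, hN]
    simp
  have hvx : G.Adj v x := by simp [hadj]
  have hvy : G.Adj v y := by simp [hadj]
  have exchange : ∀ z t : V, G.Adj z v → ¬ G.Adj z t →
      (∀ d, H.Adj z d ↔ (G.Adj z d ∧ d ≠ v) ∨ d = t) → Even (H.neighborSet z).ncard := by
    intro z t hzv hzt h
    have h1 : H.neighborSet z = insert t (G.neighborSet z \ {v}) := by
      ext d
      simp only [mem_neighborSet, h, Set.mem_insert_iff, Set.mem_sdiff, Set.mem_singleton_iff]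
      tauto
    rw [h1, Set.ncard_insert_of_notMem (by simp [hzt]), Set.ncard_sdiff_singleton_add_one
      (show v ∈ G.neighborSet z from hzv)]
    exact heven z
  by_cases hwv : w = v
  · subst hwv
    have h1 : H.neighborSet w = {a, b} := by
      ext d
      simp only [mem_neighborSet, hH, hadj, Sym2.eq_iff, Set.mem_insert_iff,
        Set.mem_singleton_iff]
      have := hvx.ne
      have := hvy.ne
      grind
    rw [h1, Set.ncard_pair hab]
    exact even_two
  by_cases hwx : w = x
  · subst hwx
    refine exchange w y hvx.symm hxyG fun d => ?_
    simp only [hH, Sym2.eq_iff]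
    grind
  by_cases hwy : w = y
  · subst hwy
    refine exchange w x hvy.symm (fun h => hxyG h.symm) fun d => ?_
    simp only [hH, Sym2.eq_iff]
    grind
  have h1 : H.neighborSet w = G.neighborSet w := by
    ext d
    simp only [mem_neighborSet, hH, Sym2.eq_iff]
    grind
  rw [h1]
  exact heven w

theorem IsMinCounterexample.adj_of_adj {V : Type} [Fintype V] {G : SimpleGraph V}
    (hG : IsMinCounterexample G) {v a b x y : V} (hN : G.neighborSet v = {a, b, x, y})
    (hab : a ≠ b) (hax : a ≠ x) (hay : a ≠ y) (hbx : b ≠ x) (hby : b ≠ y) (hxy : x ≠ y)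
    (h : G.Adj a b) : G.Adj x y := by
  by_contra hxyG
  have hadj : ∀ z, G.Adj v z ↔ z = a ∨ z = b ∨ z = x ∨ z = y := fun z => by
    rw [← mem_neighborSet, hN]
    simp
  have hva : G.Adj v a := by simp [hadj]
  have hvb : G.Adj v b := by simp [hadj]
  have hvx : G.Adj v x := by simp [hadj]
  have hvy : G.Adj v y := by simp [hadj]
  let H : SimpleGraph V :=
    fromEdgeSet {e | (e ∈ G.edgeSet ∧ e ≠ s(x, v) ∧ e ≠ s(v, y)) ∨ e = s(x, y)}
  have hH : ∀ c d, H.Adj c d ↔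
      (G.Adj c d ∧ s(c, d) ≠ s(x, v) ∧ s(c, d) ≠ s(v, y)) ∨ s(c, d) = s(x, y) := by
    intro c d
    simp only [H, fromEdgeSet_adj, Set.mem_ofPred_eq, mem_edgeSet, Sym2.eq_iff]
    have : G.Adj c d → c ≠ d := Adj.ne
    grind
  have hHe : ∀ e, e ∈ H.edgeSet ↔
      (e ∈ G.edgeSet ∧ e ≠ s(x, v) ∧ e ≠ s(v, y)) ∨ e = s(x, y) := by
    intro e
    induction e with | _ c d
    exact hH c d
  have hne : s(x, v) ≠ s(v, y) := by
    simp only [ne_eq, Sym2.eq_iff]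
    grind
  have hcard : H.edgeSet.ncard < G.edgeSet.ncard := by
    have h1 : H.edgeSet = insert s(x, y) ((G.edgeSet \ {s(x, v)}) \ {s(v, y)}) := by
      ext e
      rw [hHe]
      simp only [Set.mem_insert_iff, Set.mem_sdiff, Set.mem_singleton_iff]
      tauto
    have h2 := Set.ncard_sdiff_singleton_add_one (s := G.edgeSet) (a := s(x, v)) hvx.symm
    have h3 := Set.ncard_sdiff_singleton_add_one (s := G.edgeSet \ {s(x, v)}) (a := s(v, y))
      ⟨hvy, hne.symm⟩
    have h4 := Set.ncard_insert_le s(x, y) ((G.edgeSet \ {s(x, v)}) \ {s(v, y)})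
    rw [h1]
    omega
  have : Nonempty V := ⟨v⟩
  have hpart := hG.hasCircuitPartition _ V H rfl
    (even_ncard_neighborSet_of_split hG.1.1.2 hN hab hax hay hbx hby hxy hxyG hH)
    (Or.inr ⟨rfl, hcard⟩)
  refine hG.1.2 ((fulfilsHajos_iff G).2 ?_)
  convert hpart.subdivide (v := v) (a := a) (b := b) (x := x) (y := y) hab ?_ ?_ ?_ hva.ne hvb.ne
    hax hay hbx hby using 1
  · ext e
    simp only [Set.mem_ofPred_eq, hHe]
    have h1 : s(x, v) ∈ G.edgeSet := hvx.symm
    have h2 : s(v, y) ∈ G.edgeSet := hvy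
    have h3 : s(x, y) ∉ G.edgeSet := hxyG
    grind
  · intro e he hve
    obtain ⟨d, rfl⟩ := Sym2.mem_iff_exists.1 hve
    rw [mem_edgeSet, hH, hadj] at he
    have := hvx.ne
    have := hvy.ne
    simp only [Sym2.eq_iff] at he ⊢
    grind
  · rw [mem_edgeSet, hH]
    have := hva.ne
    have := hvb.ne
    simp only [Sym2.eq_iff]
    grind
  · rw [hHe]
    exact Or.inr rfl

/-- In a minimum counterexample, the neighbourhood of any degree-4 vertex induces a
regular graph: all vertices of the induced subgraph have the same degree. -/
theorem minCounterexample_deg_four_neighbourhood_regular {V : Type} [Fintype V]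
    (G : SimpleGraph V) (hG : IsMinCounterexample G)
    (v : V) (hv : (G.neighborSet v).ncard = 4) :
    ∃ d : ℕ, ∀ x ∈ G.neighborSet v,
      ({y ∈ G.neighborSet v | G.Adj x y}).ncard = d := by
  classical
  rw [Set.ncard_eq_toFinset_card', Finset.card_eq_four] at hv
  obtain ⟨a, b, x, y, hab, hax, hay, hbx, hby, hxy, hN'⟩ := hv
  have hN : G.neighborSet v = {a, b, x, y} := by
    rw [← Set.coe_toFinset (G.neighborSet v), hN']
    simp
  have perm : ∀ a' b' x' y' : V, ({a, b, x, y} : Set V) = {a', b', x', y'} →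
      G.neighborSet v = {a', b', x', y'} := fun _ _ _ _ h => hN.trans h
  have h1 : G.Adj a b ↔ G.Adj x y :=
    ⟨hG.adj_of_adj hN hab hax hay hbx hby hxy,
      hG.adj_of_adj (perm x y a b (by grind)) hxy hax.symm hbx.symm hay.symm hby.symm hab⟩
  have h2 : G.Adj a x ↔ G.Adj b y :=
    ⟨hG.adj_of_adj (perm a x b y (by grind)) hax hab hay hbx.symm hxy hby,
      hG.adj_of_adj (perm b y a x (by grind)) hby hab.symm hbx hay.symm hxy.symm hax⟩
  have h3 : G.Adj a y ↔ G.Adj b x :=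
    ⟨hG.adj_of_adj (perm a y b x (by grind)) hay hab hax hby.symm hxy.symm hbx,
      hG.adj_of_adj (perm b x a y (by grind)) hbx hab.symm hby hax.symm hxy hay⟩
  refine ⟨(if G.Adj a b then 1 else 0) + (if G.Adj a x then 1 else 0) +
    (if G.Adj a y then 1 else 0), fun z hz => ?_⟩
  have hcount : ({w ∈ G.neighborSet v | G.Adj z w}).ncard =
      (if G.Adj z a then 1 else 0) + ((if G.Adj z b then 1 else 0) +
        ((if G.Adj z x then 1 else 0) + (if G.Adj z y then 1 else 0))) := by
    have : {w ∈ G.neighborSet v | G.Adj z w} =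
        ((({a, b, x, y} : Finset V).filter (G.Adj z) : Finset V) : Set V) := by
      ext w
      simp [hN]
    rw [this, Set.ncard_coe_finset, Finset.card_filter, Finset.sum_insert (by simp [*]),
      Finset.sum_insert (by simp [*]), Finset.sum_insert (by simp [*]), Finset.sum_singleton]
  rw [hcount]
  rw [hN] at hz
  rcases hz with rfl | rfl | rfl | rfl <;> grind [SimpleGraph.adj_comm, SimpleGraph.irrefl]
end

section
/- Let G be a minimum counterexample to Hajós' conjecture and let v be a vertex of degree 6 in G with neighbourhood N(v) = {x₁, x₂, x₃, x₄, x₅, x₆}. If {x₁, x₂, x₃, x₄} is a 4-clique in G (all six pairs among x₁, x₂, x₃, x₄ are adjacent), then x₅x₆ is an edge of G. -/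
/-- `IsPathOn a b E X`: `E` is the edge set and `X` the vertex set of a path from `a` to `b`. -/
inductive IsPathOn {V : Type} : V → V → Set (Sym2 V) → Set V → Prop
  | nil (a : V) : IsPathOn a a ∅ {a}
  | cons {a b c : V} {E : Set (Sym2 V)} {X : Set V} (ha : a ∉ X) (h : IsPathOn b c E X) :
      IsPathOn a c (insert s(a, b) E) (insert a X)

/-- `S` is the edge set of a cycle. -/
def IsCycleOn {V : Type} (S : Set (Sym2 V)) : Prop :=
  ∃ a b E X, IsPathOn a b E X ∧ a ≠ b ∧ s(a, b) ∉ E ∧ S = insert s(a, b) E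

namespace IsPathOn

variable {V : Type} {a b c d v : V} {E F : Set (Sym2 V)} {X Y : Set V}

theorem left_mem (h : IsPathOn a b E X) : a ∈ X := by
  cases h <;> simp

theorem right_mem (h : IsPathOn a b E X) : b ∈ X := by
  induction h with
  | nil => simp
  | cons _ _ ih => exact Or.inr ih

theorem mem_of_mem (h : IsPathOn a b E X) (he : s(c, d) ∈ E) : c ∈ X ∧ d ∈ X := by
  induction h with
  | nil => simp at he
  | cons ha h ih =>
    have := h.left_mem
    grind

theorem ne_of_mem (h : IsPathOn a b E X) (he : s(c, d) ∈ E) : c ≠ d := by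
  induction h with
  | nil => simp at he
  | cons ha h ih =>
    have := h.left_mem
    grind

theorem join (h : IsPathOn a b E X) (h' : IsPathOn c d F Y) (hXY : ∀ x ∈ X, x ∉ Y) :
    IsPathOn a d (insert s(b, c) (E ∪ F)) (X ∪ Y) := by
  induction h with
  | nil a =>
    have := IsPathOn.cons (hXY a rfl) h'
    convert this using 1
    · grind
    · grind
  | @cons a b e E X ha h ih =>
    have := IsPathOn.cons (a := a) (by grind) (ih (by grind))
    convert this using 1
    · grind
    · grind

theorem reverse (h : IsPathOn a b E X) : IsPathOn b a E X := by
  induction h with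
  | nil a => exact nil a
  | @cons a b e E X ha h ih =>
    have := ih.join (nil a) (by grind)
    convert this using 1
    · grind
    · grind

theorem split (h : IsPathOn a b E X) (he : s(c, d) ∈ E) :
    ∃ E₁ X₁ E₂ X₂, (∀ x ∈ X₁, x ∉ X₂) ∧ E = insert s(c, d) (E₁ ∪ E₂) ∧ X = X₁ ∪ X₂ ∧
      (IsPathOn a c E₁ X₁ ∧ IsPathOn d b E₂ X₂ ∨ IsPathOn a d E₁ X₁ ∧ IsPathOn c b E₂ X₂) := by
  induction h with
  | nil => simp at he
  | @cons a b e E X ha h ih =>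
    by_cases hab : s(c, d) = s(a, b)
    · refine ⟨∅, {a}, E, X, by grind, by grind, by grind, ?_⟩
      have := nil a
      grind
    · obtain ⟨E₁, X₁, E₂, X₂, h1, rfl, rfl, h4⟩ := ih (by grind)
      refine ⟨insert s(a, b) E₁, insert a X₁, E₂, X₂, by grind, by grind, by grind, ?_⟩
      refine h4.imp (fun h4 => ⟨.cons (by grind) h4.1, h4.2⟩)
        (fun h4 => ⟨.cons (by grind) h4.1, h4.2⟩)

theorem eq_empty (h : IsPathOn a a E X) : E = ∅ := by
  cases h with
  | nil => rfl
  | cons ha h => exact absurd h.right_mem ha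

theorem tail (h : IsPathOn a b E X) (he : s(a, c) ∈ E) :
    ∃ F Y, IsPathOn c b F Y ∧ a ∉ Y ∧ E = insert s(a, c) F := by
  cases h with
  | nil => simp at he
  | @cons _ b' _ E X ha h =>
    have : c = b' := by
      rcases he with he | he
      · grind
      · exact absurd (h.mem_of_mem he).1 ha
    subst this
    exact ⟨E, X, h, ha, rfl⟩

theorem isCycleOn_insert (h : IsPathOn a b E X) (hab : a ≠ b) (hE : s(a, b) ∉ E) :
    IsCycleOn (insert s(a, b) E) :=
  ⟨a, b, E, X, h, hab, hE, rfl⟩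

theorem isCycleOn_close (h : IsPathOn a b E X) (hab : a ≠ b) (hv : v ∉ X) :
    IsCycleOn (insert s(v, a) (insert s(v, b) E)) := by
  have h1 := IsPathOn.cons hv h
  have h2 := h.left_mem
  have h3 := h.right_mem
  have := h1.isCycleOn_insert (by grind) (fun h' => by
    rcases h' with h' | h'
    · grind
    · exact hv (h.mem_of_mem h').1)
  rwa [Set.insert_comm] at this

end IsPathOn

namespace IsCycleOn

variable {V : Type} {a b c d v : V} {S : Set (Sym2 V)}

theorem open_edge (h : IsCycleOn S) (he : s(a, b) ∈ S) :
    ∃ E X, IsPathOn a b E X ∧ s(a, b) ∉ E ∧ a ≠ b ∧ S = insert s(a, b) E := by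
  obtain ⟨c, d, E, X, h, hcd, hE, rfl⟩ := h
  rcases he with he | he
  · rcases Sym2.eq_iff.1 he with ⟨rfl, rfl⟩ | ⟨rfl, rfl⟩
    · exact ⟨E, X, h, hE, hcd, rfl⟩
    · exact ⟨E, X, h.reverse, he ▸ hE, hcd.symm, by rw [he]⟩
  · obtain ⟨E₁, X₁, E₂, X₂, h1, rfl, rfl, ⟨h4, h5⟩ | ⟨h4, h5⟩⟩ := h.split he
    · have hj := h4.reverse.join h5.reverse h1
      refine ⟨_, _, hj, ?_, h.ne_of_mem he, by grind⟩
      have := h4.right_mem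
      have := h5.left_mem
      have := fun h => (h4.mem_of_mem (c := a) (d := b) h).2
      have := fun h => (h5.mem_of_mem (c := a) (d := b) h).1
      grind
    · have hj := (h4.reverse.join h5.reverse h1).reverse
      refine ⟨_, _, hj, ?_, h.ne_of_mem he, by grind⟩
      have := h4.right_mem
      have := h5.left_mem
      have := fun h => (h4.mem_of_mem (c := a) (d := b) h).1
      have := fun h => (h5.mem_of_mem (c := a) (d := b) h).2
      grind

theorem open_vertex (h : IsCycleOn S) (he : s(v, a) ∈ S) :
    ∃ b E X, IsPathOn a b E X ∧ v ∉ X ∧ a ≠ b ∧ S = insert s(v, a) (insert s(v, b) E) := by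
  obtain ⟨E, X, hp, h1, h2, rfl⟩ := h.open_edge he
  cases hp with
  | nil => exact absurd rfl h2
  | @cons _ b _ E X ha hp =>
    exact ⟨b, E, X, hp.reverse, ha, by grind, rfl⟩

theorem open_vertex_pair (h : IsCycleOn S) (ha : s(v, a) ∈ S) (hb : s(v, b) ∈ S) (hab : a ≠ b) :
    ∃ E X, IsPathOn a b E X ∧ v ∉ X ∧ S = insert s(v, a) (insert s(v, b) E) := by
  obtain ⟨b', E, X, hp, hv, hne, rfl⟩ := h.open_vertex ha
  have : b' = b := by
    have := fun h' => (hp.mem_of_mem (c := v) (d := b) h').1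
    grind
  subst this
  exact ⟨E, X, hp, hv, rfl⟩

/-- Subdividing an edge of a cycle by a vertex off the cycle. -/
theorem subdivide (h : IsCycleOn S) (he : s(a, b) ∈ S) (hv : ∀ x, s(v, x) ∉ S) :
    IsCycleOn (insert s(v, a) (insert s(v, b) (S \ {s(a, b)}))) := by
  obtain ⟨E, X, hp, h1, h2, rfl⟩ := h.open_edge he
  have hX : v ∉ X := by
    intro hv'
    have key : ∀ {a b : V} {E X}, IsPathOn a b E X → v ∈ X → v = b ∨ ∃ x, s(v, x) ∈ E := by
      intro a b E X h
      induction h with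
      | nil => simp
      | cons => grind
    rcases key hp hv' with rfl | ⟨x, hx⟩
    · exact hv a (by grind)
    · exact hv x (by grind)
  have := hp.isCycleOn_close h2 hX
  convert this using 3
  grind

/-- Replacing the two edges of a cycle at `v` by a chord. -/
theorem bypass (h : IsCycleOn S) (ha : s(v, a) ∈ S) (hb : s(v, b) ∈ S) (hab : a ≠ b)
    (he : s(a, b) ∉ S) :
    IsCycleOn (insert s(a, b) (S \ {s(v, a), s(v, b)})) ∧
      ∀ x, s(v, x) ∉ insert s(a, b) (S \ {s(v, a), s(v, b)}) := by
  obtain ⟨E, X, hp, hv, rfl⟩ := h.open_vertex_pair ha hb hab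
  have h1 := fun x h' => (hp.mem_of_mem (c := v) (d := x) h').1
  have := hp.left_mem
  have := hp.right_mem
  constructor
  · have := hp.isCycleOn_insert hab (by grind)
    convert this using 2
    grind
  · grind

theorem insert_sdiff_pair {α : Type} {p q r t u : α} {F : Set α} (h1 : r ≠ p)
    (h2 : r ≠ q) (h3 : p ∉ F) (h4 : q ∉ F) :
    insert u (insert t (insert p (insert r (insert q F)) \ {p, q})) =
      insert u (insert r (insert t F)) := by
  grind

theorem exchange_aux (hac : a ≠ c) (had : a ≠ d) (hbc : b ≠ c) (hbd : b ≠ d)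
    (hcd : c ≠ d) (hva : v ≠ a) (hvb : v ≠ b) {E₁ E₂ : Set (Sym2 V)} {X₁ X₂ : Set V}
    (hX : ∀ x ∈ X₁, x ∉ X₂) (h1 : IsPathOn c a E₁ X₁) (h2 : IsPathOn b d E₂ X₂)
    (hv : v ∉ X₁ ∪ X₂)
    (hS : S = insert s(v, c) (insert s(v, d) (insert s(a, b) (E₁ ∪ E₂)))) :
    s(b, c) ∉ S ∧ s(a, d) ∉ S ∧
      IsCycleOn (insert s(v, a) (insert s(b, c) (S \ {s(v, c), s(a, b)}))) ∧
      IsCycleOn (insert s(v, b) (insert s(a, d) (S \ {s(v, d), s(a, b)}))) := by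
  subst hS
  have hc := h1.left_mem
  have ha := h1.right_mem
  have hb := h2.left_mem
  have hd := h2.right_mem
  have hv1 : v ∉ X₁ := fun h => hv (Or.inl h)
  have hv2 : v ∉ X₂ := fun h => hv (Or.inr h)
  have hvc : v ≠ c := fun h => hv1 (h ▸ hc)
  have hvd : v ≠ d := fun h => hv2 (h ▸ hd)
  have m1 : ∀ x y, s(x, y) ∈ E₁ → x ∈ X₁ ∧ y ∈ X₁ := fun x y h' => h1.mem_of_mem h'
  have m2 : ∀ x y, s(x, y) ∈ E₂ → x ∈ X₂ ∧ y ∈ X₂ := fun x y h' => h2.mem_of_mem h'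
  have nv : ∀ x, s(v, x) ∉ E₁ ∪ E₂ := fun x h =>
    h.elim (fun h => hv1 (m1 _ _ h).1) (fun h => hv2 (m2 _ _ h).1)
  have cross : ∀ x y, x ∈ X₁ → y ∈ X₂ → s(x, y) ∉ E₁ ∪ E₂ := fun x y hx hy h =>
    h.elim (fun h => hX _ (m1 _ _ h).2 hy) (fun h => hX _ hx (m2 _ _ h).1)
  have hc1 := (h1.reverse.join h2 hX).isCycleOn_close (v := v) had hv
  have hc2 := (h1.join h2.reverse hX).isCycleOn_close (v := v) hbc.symm hv
  refine ⟨?_, ?_, ?_, ?_⟩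
  · rw [Sym2.eq_swap]
    have := cross c b hc hb
    simp only [Set.mem_insert_iff, Sym2.eq_iff, not_or]
    grind
  · have := cross a d ha hd
    simp only [Set.mem_insert_iff, Sym2.eq_iff, not_or]
    grind
  · rw [insert_sdiff_pair _ _ (nv c) (cross a b ha hb), Sym2.eq_swap (a := b)]
    · exact hc1
    · simpa [Sym2.eq_iff, hvc] using hcd.symm
    · simp [hva, hvb]
  · rw [Set.insert_comm s(v, c), insert_sdiff_pair _ _ (nv d) (cross a b ha hb),
      Set.insert_comm s(v, b)]
    · exact hc2
    · simpa [Sym2.eq_iff, hvd] using hcd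
    · simp [hva, hvb]

/-- Exchanging two edges of a cycle against two others; `v c` and `v d` are the edges at `v`
and `a b` is a further edge, traversed in the order `c, …, a, b, …, d` or `c, …, b, a, …, d`. -/
theorem exchange (h : IsCycleOn S) (hc : s(v, c) ∈ S) (hd : s(v, d) ∈ S) (hcd : c ≠ d)
    (hab : s(a, b) ∈ S) (hac : a ≠ c) (had : a ≠ d) (hbc : b ≠ c) (hbd : b ≠ d)
    (hva : v ≠ a) (hvb : v ≠ b) :
    (s(b, c) ∉ S ∧ s(a, d) ∉ S ∧
      IsCycleOn (insert s(v, a) (insert s(b, c) (S \ {s(v, c), s(a, b)}))) ∧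
      IsCycleOn (insert s(v, b) (insert s(a, d) (S \ {s(v, d), s(a, b)})))) ∨
    (s(a, c) ∉ S ∧ s(b, d) ∉ S ∧
      IsCycleOn (insert s(v, b) (insert s(a, c) (S \ {s(v, c), s(a, b)}))) ∧
      IsCycleOn (insert s(v, a) (insert s(b, d) (S \ {s(v, d), s(a, b)})))) := by
  obtain ⟨E, X, hp, hv, rfl⟩ := h.open_vertex_pair hc hd hcd
  have hE : s(a, b) ∈ E := by
    simpa [hva.symm, hvb.symm] using hab
  obtain ⟨E₁, X₁, E₂, X₂, h1, hE, rfl, ⟨h4, h5⟩ | ⟨h4, h5⟩⟩ := hp.split hE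
  · left
    exact exchange_aux hac had hbc hbd hcd hva hvb h1 h4 h5 hv (by rw [hE])
  · right
    have := exchange_aux (S := insert s(v, c) (insert s(v, d) E)) hbc hbd hac had hcd hvb hva
      h1 h4 h5 hv
      (by rw [hE, Sym2.eq_swap (a := a) (b := b)])
    rwa [Sym2.eq_swap (a := b) (b := a)] at this

/-- A cycle with the path `d a v b c` and the edge `c d` is a pentagon. -/
theorem eq_of_pentagon (h : IsCycleOn S) (ha : s(v, a) ∈ S) (hb : s(v, b) ∈ S) (hab : a ≠ b)
    (had : s(a, d) ∈ S) (hbc : s(b, c) ∈ S) (hcd : s(c, d) ∈ S) (hac : a ≠ c) (hbd : b ≠ d)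
    (hvc : v ≠ c) (hvd : v ≠ d) :
    S = {s(v, a), s(v, b), s(a, d), s(b, c), s(c, d)} := by
  obtain ⟨E, X, hp, hv, rfl⟩ := h.open_vertex_pair ha hb hab
  have ha' := hp.left_mem
  have hb' := hp.right_mem
  have hva : v ≠ a := fun h => hv (h ▸ ha')
  have hvb : v ≠ b := fun h => hv (h ▸ hb')
  simp only [Set.mem_insert_iff, Sym2.eq_iff] at had hbc hcd
  obtain ⟨F, Y, h', hY, rfl⟩ := hp.tail (c := d) (by grind)
  simp only [Set.mem_insert_iff, Sym2.eq_iff] at hbc hcd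
  obtain ⟨F', Y', h'', hY', rfl⟩ := h'.reverse.tail (c := c) (by grind)
  simp only [Set.mem_insert_iff, Sym2.eq_iff] at hcd
  obtain ⟨F'', Y'', h''', hY'', rfl⟩ := h''.tail (c := d) (by grind)
  rw [h'''.eq_empty, insert_empty_eq]

end IsCycleOn

namespace IsPathOn

variable {V W : Type} {a b : V} {E : Set (Sym2 V)} {X : Set V}

theorem map (h : IsPathOn a b E X) {f : V → W} (hf : f.Injective) :
    IsPathOn (f a) (f b) (Sym2.map f '' E) (f '' X) := by
  induction h with
  | nil a => simpa using IsPathOn.nil (f a)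
  | cons ha _ ih =>
    rw [Set.image_insert_eq, Set.image_insert_eq]
    exact ih.cons (by simpa [hf.eq_iff] using ha)

theorem exists_walk (h : IsPathOn a b E X) {H : SimpleGraph V} (hE : E ⊆ H.edgeSet) :
    ∃ w : H.Walk a b, w.IsPath ∧ (∀ e, e ∈ w.edges ↔ e ∈ E) ∧ ∀ x, x ∈ w.support ↔ x ∈ X := by
  induction h with
  | nil => exact ⟨.nil, by simp⟩
  | cons ha _ ih =>
    rw [Set.insert_subset_iff] at hE
    obtain ⟨w, h1, h2, h3⟩ := ih hE.2
    have hadj : H.Adj _ _ := hE.1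
    refine ⟨.cons hadj w, (SimpleGraph.Walk.cons_isPath_iff _ _).2 ⟨h1, by rwa [h3]⟩, ?_, ?_⟩
    · simp [h2]
    · simp [h3]

end IsPathOn

theorem SimpleGraph.Walk.IsPath.isPathOn {V : Type} {H : SimpleGraph V} {a b : V}
    {w : H.Walk a b} (h : w.IsPath) : IsPathOn a b {e | e ∈ w.edges} {x | x ∈ w.support} := by
  induction w with
  | nil => simpa using IsPathOn.nil _
  | cons hab w ih =>
    rw [SimpleGraph.Walk.cons_isPath_iff] at h
    convert IsPathOn.cons (a := _) _ (ih h.1) using 1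
    · ext; simp
    · ext; simp
    · exact h.2

theorem SimpleGraph.Walk.IsCycle.isCycleOn {V : Type} {H : SimpleGraph V} {a : V}
    {w : H.Walk a a} (h : w.IsCycle) : IsCycleOn {e | e ∈ w.edges} := by
  cases w with
  | nil => simp at h
  | cons hab w =>
    rw [SimpleGraph.Walk.cons_isCycle_iff] at h
    refine ⟨_, _, _, _, h.1.isPathOn.reverse, hab.ne, h.2, ?_⟩
    ext; simp

namespace IsCycleOn

variable {V W : Type} {S : Set (Sym2 V)}

theorem map (h : IsCycleOn S) {f : V → W} (hf : f.Injective) : IsCycleOn (Sym2.map f '' S) := by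
  obtain ⟨a, b, E, X, hp, hab, hE, rfl⟩ := h
  refine ⟨f a, f b, _, _, hp.map hf, hf.ne hab, ?_, by rw [Set.image_insert_eq]; rfl⟩
  rintro ⟨e, he, hfe⟩
  exact hE (Sym2.map.injective hf (hfe.trans (Sym2.map_mk f a b).symm) ▸ he)

theorem exists_walk (h : IsCycleOn S) {H : SimpleGraph V} (hS : S ⊆ H.edgeSet) :
    ∃ (a : V) (w : H.Walk a a), w.IsCycle ∧ ∀ e, e ∈ w.edges ↔ e ∈ S := by
  obtain ⟨a, b, E, X, hp, hab, hE, rfl⟩ := h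
  rw [Set.insert_subset_iff] at hS
  obtain ⟨w, h1, h2, h3⟩ := hp.reverse.exists_walk hS.2
  have hadj : H.Adj _ _ := hS.1
  refine ⟨a, .cons hadj w, (SimpleGraph.Walk.cons_isCycle_iff _ _).2 ⟨h1, by rwa [h2]⟩, ?_⟩
  simp [h2]

end IsCycleOn

/-- The colour classes of `col` on `E` are `m` cycles. -/
def IsCycleColoring {V : Type} (E : Set (Sym2 V)) (m : ℕ) (col : Sym2 V → ℕ) : Prop :=
  (∀ e ∈ E, col e < m) ∧ ∀ i < m, IsCycleOn {e | e ∈ E ∧ col e = i}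

theorem fulfilsHajos_iff_s5 {V : Type} [Fintype V] (H : SimpleGraph V) :
    FulfilsHajos H ↔
      ∃ m ≤ (Fintype.card V - 1) / 2, ∃ col, IsCycleColoring H.edgeSet m col := by
  classical
  constructor
  · rintro ⟨m, B, c, hm, hc, hdisj, hcov⟩
    refine ⟨m, hm, fun e => if h : ∃ i, e ∈ (c i).edges then (h.choose : ℕ) else 0, ?_, ?_⟩
    · intro e he
      have h := (hcov e).1 he
      simp only [h, dite_true]
      exact h.choose.2
    · intro i hi
      convert (hc ⟨i, hi⟩).isCycleOn using 1
      ext e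
      constructor
      · rintro ⟨he, hei⟩
        have h := (hcov e).1 he
        simp only [h, dite_true] at hei
        have := h.choose_spec
        subst hei
        exact this
      · intro he
        have h : ∃ i, e ∈ (c i).edges := ⟨_, he⟩
        refine ⟨(hcov e).2 h, ?_⟩
        simp only [h, dite_true]
        by_contra hne
        exact hdisj _ _ (fun h' => hne (congrArg Fin.val h')) e h.choose_spec he
  · rintro ⟨m, hm, col, h1, h2⟩
    have key : ∀ i : Fin m, ∃ (a : V) (w : H.Walk a a), w.IsCycle ∧
        ∀ e, e ∈ w.edges ↔ e ∈ H.edgeSet ∧ col e = i :=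
      fun i => (h2 i i.2).exists_walk fun e he => he.1
    choose B c hc hce using key
    refine ⟨m, B, c, hm, hc, ?_, ?_⟩
    · intro i j hij e hi hj
      rw [hce] at hi hj
      exact hij (Fin.ext (hi.2.symm.trans hj.2))
    · intro e
      constructor
      · intro he
        exact ⟨⟨col e, h1 e he⟩, (hce _ _).2 ⟨he, rfl⟩⟩
      · rintro ⟨i, hi⟩
        exact ((hce _ _).1 hi).1

/-- Cycle colourings of the two sides of an edgeless cut combine. -/
theorem IsCycleColoring.union {V W₁ W₂ : Type} {E : Set (Sym2 V)}
    {f₁ : W₁ → V} {f₂ : W₂ → V} (hf₁ : f₁.Injective) (hf₂ : f₂.Injective)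
    {E₁ : Set (Sym2 W₁)} {E₂ : Set (Sym2 W₂)}
    (hE : E = Sym2.map f₁ '' E₁ ∪ Sym2.map f₂ '' E₂)
    (hd : Disjoint (Sym2.map f₁ '' E₁) (Sym2.map f₂ '' E₂)) {m₁ m₂ : ℕ} {c₁ : Sym2 W₁ → ℕ}
    {c₂ : Sym2 W₂ → ℕ} (h₁ : IsCycleColoring E₁ m₁ c₁) (h₂ : IsCycleColoring E₂ m₂ c₂) :
    ∃ col, IsCycleColoring E (m₁ + m₂) col := by
  classical
  have hi₁ := Sym2.map.injective hf₁
  have hi₂ := Sym2.map.injective hf₂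
  set col : Sym2 V → ℕ := fun e => if h : ∃ x ∈ E₁, Sym2.map f₁ x = e then c₁ h.choose else
    if h : ∃ x, Sym2.map f₂ x = e then m₁ + c₂ h.choose else 0 with hcol
  have e₁ : ∀ x ∈ E₁, col (Sym2.map f₁ x) = c₁ x := by
    intro x hx
    have h : ∃ y ∈ E₁, Sym2.map f₁ y = Sym2.map f₁ x := ⟨x, hx, rfl⟩
    simp only [hcol, h, dite_true]
    rw [hi₁ h.choose_spec.2]
  have e₂ : ∀ x ∈ E₂, col (Sym2.map f₂ x) = m₁ + c₂ x := by
    intro x hx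
    have h' : ¬ ∃ y ∈ E₁, Sym2.map f₁ y = Sym2.map f₂ x := by
      rintro ⟨y, hy, hyx⟩
      exact Set.disjoint_left.1 hd ⟨y, hy, hyx⟩ ⟨x, hx, rfl⟩
    have h : ∃ y, Sym2.map f₂ y = Sym2.map f₂ x := ⟨x, rfl⟩
    simp only [hcol, h', h, dite_true, dite_false]
    rw [hi₂ h.choose_spec]
  refine ⟨col, ?_, ?_⟩
  · subst hE
    rintro _ (⟨x, hx, rfl⟩ | ⟨x, hx, rfl⟩)
    · have := h₁.1 x hx
      rw [e₁ x hx]; omega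
    · have := h₂.1 x hx
      rw [e₂ x hx]; omega
  · intro i hi
    by_cases him : i < m₁
    · convert (h₁.2 i him).map hf₁ using 1
      ext e
      constructor
      · rintro ⟨he, hei⟩
        rw [hE] at he
        obtain ⟨x, hx, rfl⟩ | ⟨x, hx, rfl⟩ := he
        · exact ⟨x, ⟨hx, (e₁ x hx).symm.trans hei⟩, rfl⟩
        · rw [e₂ x hx] at hei
          omega
      · rintro ⟨x, ⟨hx, hxi⟩, rfl⟩
        exact ⟨hE ▸ Or.inl ⟨x, hx, rfl⟩, (e₁ x hx).trans hxi⟩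
    · convert (h₂.2 (i - m₁) (by omega)).map hf₂ using 1
      ext e
      constructor
      · rintro ⟨he, hei⟩
        rw [hE] at he
        obtain ⟨x, hx, rfl⟩ | ⟨x, hx, rfl⟩ := he
        · have := h₁.1 x hx
          rw [e₁ x hx] at hei
          omega
        · rw [e₂ x hx] at hei
          exact ⟨x, ⟨hx, by omega⟩, rfl⟩
      · rintro ⟨x, ⟨hx, hxi⟩, rfl⟩
        exact ⟨hE ▸ Or.inr ⟨x, hx, rfl⟩, by rw [e₂ x hx]; omega⟩

/-- An even graph that is smaller than a minimum counterexample, connected or not, fulfils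
the bound of Hajós' conjecture. -/
theorem IsMinCounterexample.fulfilsHajos_of_even {V : Type} [Fintype V] {G : SimpleGraph V}
    (hG : IsMinCounterexample G) (k : ℕ) : ∀ (W : Type) [Fintype W] (H : SimpleGraph W),
    Fintype.card W = k → k ≤ Fintype.card V →
    (k = Fintype.card V → H.edgeSet.ncard < G.edgeSet.ncard) →
    (∀ w, Even (H.neighborSet w).ncard) → FulfilsHajos H := by
  classical
  induction k using Nat.strong_induction_on with
  | _ k ih =>
    intro W _ H hk hkV hcard heven
    by_cases hconn : H.Connected
    · by_contra hH
      have hc : IsCounterexample H := ⟨⟨hconn, heven⟩, hH⟩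
      have h1 := hG.2.1 W H hc
      have h2 := hG.2.2 W H hc (by omega)
      have h3 := hcard (by omega)
      omega
    rcases isEmpty_or_nonempty W with hW | ⟨⟨w₀⟩⟩
    · rw [fulfilsHajos_iff_s5]
      refine ⟨0, by omega, fun _ => 0, ?_, by simp⟩
      intro e
      induction e with
      | _ x y => exact hW.elim x
    set S : Set W := {w | H.Reachable w₀ w} with hS
    have hcut : ∀ x y, H.Adj x y → (x ∈ S ↔ y ∈ S) := fun x y hxy =>
      ⟨fun h => h.trans hxy.reachable, fun h => h.trans hxy.symm.reachable⟩
    have hne : ∃ w, w ∉ S := by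
      by_contra! h
      exact hconn ((SimpleGraph.connected_iff_exists_forall_reachable H).2 ⟨w₀, h⟩)
    obtain ⟨w₁, hw₁⟩ := hne
    have hw₀ : w₀ ∈ S := SimpleGraph.Reachable.refl w₀
    have heven' : ∀ T : Set W, (∀ x y, H.Adj x y → (x ∈ T ↔ y ∈ T)) → ∀ w : T,
        Even ((H.induce T).neighborSet w).ncard := by
      intro T hT w
      rw [← Set.ncard_image_of_injective _ Subtype.val_injective]
      convert heven w using 2
      ext x
      simp only [Set.mem_image, SimpleGraph.mem_neighborSet, SimpleGraph.comap_adj,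
        Function.Embedding.subtype_apply, Subtype.exists, exists_and_right, exists_eq_right]
      exact ⟨fun ⟨_, h⟩ => h, fun h => ⟨(hT _ _ h).1 w.2, h⟩⟩
    have hsum : Fintype.card S + Fintype.card (Sᶜ : Set W) = Fintype.card W := by
      rw [Fintype.card_compl_set]
      have := set_fintype_card_le_univ S
      omega
    have hpos₁ : 0 < Fintype.card S := Fintype.card_pos_iff.2 ⟨⟨w₀, hw₀⟩⟩
    have hpos₂ : 0 < Fintype.card (Sᶜ : Set W) := Fintype.card_pos_iff.2 ⟨⟨w₁, hw₁⟩⟩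
    have h₁ := ih (Fintype.card S) (by omega) S (H.induce S) rfl (by omega) (by omega)
      (heven' S hcut)
    have h₂ := ih (Fintype.card (Sᶜ : Set W)) (by omega) (Sᶜ : Set W) (H.induce Sᶜ) rfl
      (by omega) (by omega) (heven' Sᶜ fun x y h => not_congr (hcut x y h))
    rw [fulfilsHajos_iff_s5] at h₁ h₂ ⊢
    obtain ⟨m₁, hm₁, c₁, hc₁⟩ := h₁
    obtain ⟨m₂, hm₂, c₂, hc₂⟩ := h₂
    refine ⟨m₁ + m₂, by omega, IsCycleColoring.union Subtype.val_injective
      Subtype.val_injective ?_ ?_ hc₁ hc₂⟩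
    · ext e
      induction e with
      | _ x y =>
        constructor
        · intro h
          by_cases hx : x ∈ S
          · exact Or.inl ⟨s(⟨x, hx⟩, ⟨y, (hcut x y h).1 hx⟩), h, rfl⟩
          · exact Or.inr ⟨s(⟨x, hx⟩, ⟨y, fun hy => hx ((hcut x y h).2 hy)⟩), h, rfl⟩
        · rintro (⟨e, he, hxy⟩ | ⟨e, he, hxy⟩) <;>
          · induction e with
            | _ a b =>
              rw [← hxy]
              exact he
    · rw [Set.disjoint_left]
      rintro _ ⟨e, he, rfl⟩ ⟨e', he', hee⟩
      induction e with
      | _ a b =>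
        induction e' with
        | _ c d =>
          have : (c : W) ∈ S := by
            rcases Sym2.eq_iff.1 hee with h | h
            · exact h.1 ▸ a.2
            · exact h.1 ▸ b.2
          exact c.2 this

namespace IsCycleColoring

variable {V : Type} {E : Set (Sym2 V)} {m p q r : ℕ} {col : Sym2 V → ℕ} {e f g : Sym2 V}

/-- Replacing the edge `e` by two edges of the same colour. -/
theorem replace (h : IsCycleColoring E m col) (he : e ∈ E)
    (hf : f ∉ E) (hg : g ∉ E)
    (hP : IsCycleOn (insert f (insert g ({x | x ∈ E ∧ col x = col e} \ {e})))) :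
    ∃ col', IsCycleColoring (insert f (insert g (E \ {e}))) m col' := by
  classical
  refine ⟨fun x => if x = f ∨ x = g then col e else col x, ?_, ?_⟩
  · have := h.1
    grind
  · intro i hi
    by_cases hie : i = col e
    · subst hie
      convert hP using 1
      ext x
      grind
    · convert h.2 i hi using 1
      ext x
      simp only [Set.mem_ofPred_eq, Set.mem_insert_iff, Set.mem_sdiff, Set.mem_singleton_iff]
      grind

/-- Redistributing three colour classes while replacing the edge `e` by two edges. -/
theorem redistribute (h : IsCycleColoring E m col) (he : e ∈ E) (hp : col e = p)
    (hqm : q < m) (hrm : r < m) (hpq : p ≠ q) (hpr : p ≠ r) (hqr : q ≠ r)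
    (hf : f ∉ E) (hg : g ∉ E) {P Q R : Set (Sym2 V)}
    (hP : IsCycleOn P) (hQ : IsCycleOn Q) (hR : IsCycleOn R)
    (hPQ : ∀ x ∈ P, x ∉ Q) (hPR : ∀ x ∈ P, x ∉ R) (hQR : ∀ x ∈ Q, x ∉ R)
    (hU : ∀ x, x ∈ P ∨ x ∈ Q ∨ x ∈ R ↔
      x = f ∨ x = g ∨ (x ∈ E ∧ (col x = p ∨ col x = q ∨ col x = r)) ∧ x ≠ e) :
    ∃ col', IsCycleColoring (insert f (insert g (E \ {e}))) m col' := by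
  classical
  have hpm : p < m := hp ▸ h.1 e he
  refine ⟨fun x => if x ∈ P then p else if x ∈ Q then q else if x ∈ R then r else col x, ?_, ?_⟩
  · have := h.1
    grind
  · intro i hi
    by_cases hip : i = p
    · convert hP using 1
      ext x
      grind
    by_cases hiq : i = q
    · convert hQ using 1
      ext x
      grind
    by_cases hir : i = r
    · convert hR using 1
      ext x
      grind
    · convert h.2 i hi using 1
      ext x
      simp only [Set.mem_ofPred_eq, Set.mem_insert_iff, Set.mem_sdiff, Set.mem_singleton_iff]
      grind

/-- Redistribution moving `t`, `u` to the class of `w` and `w` to the class of `e`. -/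
theorem redistribute_two (h : IsCycleColoring E m col) {t u w : Sym2 V} (he : e ∈ E)
    (ht : t ∈ E) (hu : u ∈ E) (hw : w ∈ E) (hct : col t = col e) (hcu : col u = col e)
    (hcw : col w ≠ col e) (hq : q < m) (hqe : q ≠ col e) (hqw : q ≠ col w)
    (hte : t ≠ e) (hue : u ≠ e) (hf : f ∉ E) (hg : g ∉ E)
    (hP : IsCycleOn (insert f (insert g (insert w ({z | z ∈ E ∧ col z = col e} \ {t, u}) \ {e}))))
    (hR : IsCycleOn (insert t (insert u ({z | z ∈ E ∧ col z = col w} \ {w})))) :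
    ∃ col', IsCycleColoring (insert f (insert g (E \ {e}))) m col' := by
  have hwm := h.1 w hw
  refine h.redistribute he rfl hq hwm hqe.symm hcw.symm hqw hf hg hP (h.2 q hq) hR ?_ ?_ ?_ ?_ <;>
  · intro z
    simp only [Set.mem_ofPred_eq, Set.mem_insert_iff, Set.mem_sdiff, Set.mem_singleton_iff]
    grind

/-- Redistribution moving `w` to the class of `e`, `t` and `k` to the class of `w`, and
`u` and `l` to the class of `k`. -/
theorem redistribute_three (h : IsCycleColoring E m col) {t u w k l : Sym2 V} (he : e ∈ E)
    (ht : t ∈ E) (hu : u ∈ E) (hw : w ∈ E) (hl : l ∈ E) (hk : k ∈ E)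
    (hct : col t = col e) (hcu : col u = col e) (hcw : col w ≠ col e) (hcl : col l = col w)
    (hke : col k ≠ col e) (hkw : col k ≠ col w)
    (hte : t ≠ e) (hue : u ≠ e) (htu : t ≠ u) (hlw : l ≠ w) (hf : f ∉ E) (hg : g ∉ E)
    (hP : IsCycleOn (insert f (insert g (insert w ({z | z ∈ E ∧ col z = col e} \ {t, u}) \ {e}))))
    (hQ : IsCycleOn (insert t (insert k ({z | z ∈ E ∧ col z = col w} \ {l, w}))))
    (hR : IsCycleOn (insert u (insert l ({z | z ∈ E ∧ col z = col k} \ {k})))) :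
    ∃ col', IsCycleColoring (insert f (insert g (E \ {e}))) m col' := by
  have hwm := h.1 w hw
  have hkm := h.1 k hk
  refine h.redistribute he rfl hwm hkm hcw.symm hke.symm hkw.symm hf hg hP hQ hR ?_ ?_ ?_ ?_ <;>
  · intro z
    simp only [Set.mem_ofPred_eq, Set.mem_insert_iff, Set.mem_sdiff, Set.mem_singleton_iff]
    grind

/-- Redistribution moving `w` to the class of `e`, `t`, `u` and `k` to the class of `w`, and
`l` and `n` to the class of `k`. -/
theorem redistribute_four (h : IsCycleColoring E m col) {t u w k l n : Sym2 V} (he : e ∈ E)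
    (ht : t ∈ E) (hu : u ∈ E) (hw : w ∈ E) (hl : l ∈ E) (hn : n ∈ E) (hk : k ∈ E)
    (hct : col t = col e) (hcu : col u = col e) (hcw : col w ≠ col e) (hcl : col l = col w)
    (hcn : col n = col w) (hke : col k ≠ col e) (hkw : col k ≠ col w)
    (hte : t ≠ e) (hue : u ≠ e) (hlw : l ≠ w) (hnw : n ≠ w) (hf : f ∉ E) (hg : g ∉ E)
    (hP : IsCycleOn (insert f (insert g (insert w ({z | z ∈ E ∧ col z = col e} \ {t, u}) \ {e}))))
    (hQ : IsCycleOn (insert t (insert u (insert k ({z | z ∈ E ∧ col z = col w} \ {l, n}) \ {w}))))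
    (hR : IsCycleOn (insert l (insert n ({z | z ∈ E ∧ col z = col k} \ {k})))) :
    ∃ col', IsCycleColoring (insert f (insert g (E \ {e}))) m col' := by
  have hwm := h.1 w hw
  have hkm := h.1 k hk
  refine h.redistribute he rfl hwm hkm hcw.symm hke.symm hkw.symm hf hg hP hQ hR ?_ ?_ ?_ ?_ <;>
  · intro z
    simp only [Set.mem_ofPred_eq, Set.mem_insert_iff, Set.mem_sdiff, Set.mem_singleton_iff]
    grind

end IsCycleColoring

/-- In the edge set `E` the vertex `v` has exactly the neighbours `a`, `b`, `c`, `d`, which are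
pairwise adjacent, and `x y` is an edge avoiding these five vertices. -/
structure IsCliqueConfig {V : Type} (E : Set (Sym2 V)) (v a b c d x y : V) : Prop where
  nodup : [v, a, b, c, d, x, y].Nodup
  va : s(v, a) ∈ E
  vb : s(v, b) ∈ E
  vc : s(v, c) ∈ E
  vd : s(v, d) ∈ E
  ab : s(a, b) ∈ E
  ac : s(a, c) ∈ E
  ad : s(a, d) ∈ E
  bc : s(b, c) ∈ E
  bd : s(b, d) ∈ E
  cd : s(c, d) ∈ E
  xy : s(x, y) ∈ E
  nbr : ∀ z, s(v, z) ∈ E → z = a ∨ z = b ∨ z = c ∨ z = d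

namespace IsCliqueConfig

variable {V : Type} {E : Set (Sym2 V)} {v a b c d x y : V} {m : ℕ} {col : Sym2 V → ℕ}

theorem swap_left (h : IsCliqueConfig E v a b c d x y) : IsCliqueConfig E v b a c d x y where
  nodup := by have := h.nodup; grind
  va := h.vb
  vb := h.va
  vc := h.vc
  vd := h.vd
  ab := Sym2.eq_swap ▸ h.ab
  ac := h.bc
  ad := h.bd
  bc := h.ac
  bd := h.ad
  cd := h.cd
  xy := h.xy
  nbr z hz := by have := h.nbr z hz; tauto

theorem swap_middle (h : IsCliqueConfig E v a b c d x y) : IsCliqueConfig E v a c b d x y where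
  nodup := by have := h.nodup; grind
  va := h.va
  vb := h.vc
  vc := h.vb
  vd := h.vd
  ab := h.ac
  ac := h.ab
  ad := h.ad
  bc := Sym2.eq_swap ▸ h.bc
  bd := h.cd
  cd := h.bd
  xy := h.xy
  nbr z hz := by have := h.nbr z hz; tauto

theorem swap_right (h : IsCliqueConfig E v a b c d x y) : IsCliqueConfig E v a b d c x y where
  nodup := by have := h.nodup; grind
  va := h.va
  vb := h.vb
  vc := h.vd
  vd := h.vc
  ab := h.ab
  ac := h.ad
  ad := h.ac
  bc := h.bd
  bd := h.bc
  cd := Sym2.eq_swap ▸ h.cd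
  xy := h.xy
  nbr z hz := by have := h.nbr z hz; tauto

end IsCliqueConfig

namespace IsCliqueConfig

variable {V : Type} {E : Set (Sym2 V)} {v a b c d x y : V} {m : ℕ} {col : Sym2 V → ℕ}

theorem vx_notMem (h : IsCliqueConfig E v a b c d x y) : s(v, x) ∉ E := fun hx => by
  have := h.nodup
  have := h.nbr x hx
  grind

theorem vy_notMem (h : IsCliqueConfig E v a b c d x y) : s(v, y) ∉ E := fun hy => by
  have := h.nodup
  have := h.nbr y hy
  grind

theorem col_ne (h : IsCliqueConfig E v a b c d x y) (hc : IsCycleColoring E m col)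
    (ha : col s(v, a) = col s(x, y)) (hb : col s(v, b) = col s(x, y)) :
    col s(a, b) ≠ col s(x, y) := by
  intro hab
  have hnd := h.nodup
  obtain ⟨F, X, hp, hv, hF⟩ := (hc.2 _ (hc.1 _ h.xy)).open_vertex_pair (v := v) (a := a) (b := b)
    ⟨h.va, ha⟩ ⟨h.vb, hb⟩ (by grind)
  have habF : s(a, b) ∈ F := by
    have : s(a, b) ∈ insert s(v, a) (insert s(v, b) F) := hF ▸ ⟨h.ab, hab⟩
    simp only [Set.mem_insert_iff, Sym2.eq_iff] at this
    grind
  obtain ⟨F', X', hp', -, rfl⟩ := hp.tail habF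
  rw [hp'.eq_empty] at hF
  have : s(x, y) ∈ (insert s(v, a) (insert s(v, b) (insert s(a, b) ∅)) : Set (Sym2 V)) :=
    hF ▸ ⟨h.xy, rfl⟩
  simp only [Set.mem_insert_iff, Sym2.eq_iff, Set.mem_empty_iff_false] at this
  grind

theorem isCycleOn_shift (h : IsCliqueConfig E v a b c d x y) (hc : IsCycleColoring E m col)
    (ha : col s(v, a) = col s(x, y)) (hb : col s(v, b) = col s(x, y)) :
    IsCycleOn (insert s(v, x) (insert s(v, y)
      (insert s(a, b) ({z | z ∈ E ∧ col z = col s(x, y)} \ {s(v, a), s(v, b)}) \ {s(x, y)}))) := by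
  have hnd := h.nodup
  have hab := h.col_ne hc ha hb
  obtain ⟨h1, h2⟩ := (hc.2 _ (hc.1 _ h.xy)).bypass (v := v) (a := a) (b := b)
    ⟨h.va, ha⟩ ⟨h.vb, hb⟩ (by grind) (fun h' => hab h'.2)
  refine h1.subdivide (Or.inr ⟨⟨h.xy, rfl⟩, ?_⟩) h2
  simp only [Set.mem_insert_iff, Set.mem_singleton_iff, Sym2.eq_iff]
  grind

/-- A class without an edge at `v` can be subdivided by `v`. -/
theorem isCycleOn_subdivide (hc : IsCycleColoring E m col) {e f : V} (he : s(e, f) ∈ E)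
    (hv : ∀ z, s(v, z) ∈ E → col s(v, z) ≠ col s(e, f)) :
    IsCycleOn (insert s(v, e) (insert s(v, f)
      ({z | z ∈ E ∧ col z = col s(e, f)} \ {s(e, f)}))) :=
  (hc.2 _ (hc.1 _ he)).subdivide ⟨he, rfl⟩ fun z hz => hv z hz.1 hz.2

theorem recolor_of_col_ne (h : IsCliqueConfig E v a b c d x y) (hc : IsCycleColoring E m col)
    (ha : col s(v, a) = col s(x, y)) (hb : col s(v, b) = col s(x, y))
    (hcq : col s(v, c) ≠ col s(x, y)) (hcd : col s(v, d) = col s(v, c))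
    (hab : col s(a, b) ≠ col s(v, c)) :
    ∃ col', IsCycleColoring (insert s(v, x) (insert s(v, y) (E \ {s(x, y)}))) m col' := by
  have hnd := h.nodup
  have hne := h.col_ne hc ha hb
  refine hc.redistribute_two h.xy h.va h.vb h.ab ha hb hne (hc.1 _ h.vc) hcq hab.symm
    ?_ ?_ h.vx_notMem h.vy_notMem (h.isCycleOn_shift hc ha hb)
    (isCycleOn_subdivide hc h.ab fun z hz => ?_)
  · rw [Ne, Sym2.eq_iff]; grind
  · rw [Ne, Sym2.eq_iff]; grind
  · have := h.nbr z hz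
    grind

theorem recolor_of_exchange (h : IsCliqueConfig E v a b c d x y) (hc : IsCycleColoring E m col)
    (ha : col s(v, a) = col s(x, y)) (hb : col s(v, b) = col s(x, y))
    (hcq : col s(v, c) ≠ col s(x, y)) (hcd : col s(v, d) = col s(v, c))
    (hab : col s(a, b) = col s(v, c)) (hbc : col s(b, c) ≠ col s(v, c))
    (hbcp : col s(b, c) ≠ col s(x, y))
    (hQ : IsCycleOn (insert s(v, a) (insert s(b, c)
      ({z | z ∈ E ∧ col z = col s(v, c)} \ {s(v, c), s(a, b)})))) :
    ∃ col', IsCycleColoring (insert s(v, x) (insert s(v, y) (E \ {s(x, y)}))) m col' := by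
  have hnd := h.nodup
  have hne := h.col_ne hc ha hb
  rw [← hab] at hQ
  refine hc.redistribute_three h.xy h.va h.vb h.ab h.vc h.bc ha hb hne hab.symm hbcp
    (hab ▸ hbc) ?_ ?_ ?_ ?_ h.vx_notMem h.vy_notMem (h.isCycleOn_shift hc ha hb) hQ
    (isCycleOn_subdivide hc h.bc fun z hz => ?_)
  · rw [Ne, Sym2.eq_iff]; grind
  · rw [Ne, Sym2.eq_iff]; grind
  · rw [Ne, Sym2.eq_iff]; grind
  · rw [Ne, Sym2.eq_iff]; grind
  · have := h.nbr z hz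
    grind

theorem recolor_of_pentagon (h : IsCliqueConfig E v a b c d x y) (hc : IsCycleColoring E m col)
    (ha : col s(v, a) = col s(x, y)) (hb : col s(v, b) = col s(x, y))
    (hcq : col s(v, c) ≠ col s(x, y)) (hcd : col s(v, d) = col s(v, c))
    (hab : col s(a, b) = col s(v, c)) (hbc : col s(b, c) = col s(x, y))
    (had : col s(a, d) = col s(x, y)) :
    ∃ col', IsCycleColoring (insert s(v, x) (insert s(v, y) (E \ {s(x, y)}))) m col' := by
  have hnd := h.nodup
  have hne := h.col_ne hc ha hb
  have hcdp : col s(c, d) ≠ col s(x, y) := by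
    intro hcdp
    have hP := (hc.2 _ (hc.1 _ h.xy)).eq_of_pentagon (v := v) (a := a) (b := b) (c := c) (d := d)
      ⟨h.va, ha⟩ ⟨h.vb, hb⟩ (by grind) ⟨h.ad, had⟩ ⟨h.bc, hbc⟩ ⟨h.cd, hcdp⟩ (by grind) (by grind)
      (by grind) (by grind)
    have : s(x, y) ∈ ({s(v, a), s(v, b), s(a, d), s(b, c), s(c, d)} : Set (Sym2 V)) :=
      hP ▸ ⟨h.xy, rfl⟩
    simp only [Set.mem_insert_iff, Set.mem_singleton_iff, Sym2.eq_iff] at this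
    grind
  have hcdq : col s(c, d) ≠ col s(v, c) := by
    intro hcdq
    obtain ⟨F, X, hp, hv, hF⟩ := (hc.2 _ (hc.1 _ h.vc)).open_vertex_pair
      (v := v) (a := c) (b := d) ⟨h.vc, rfl⟩ ⟨h.vd, hcd⟩ (by grind)
    have hcdF : s(c, d) ∈ F := by
      have : s(c, d) ∈ insert s(v, c) (insert s(v, d) F) := hF ▸ ⟨h.cd, hcdq⟩
      simp only [Set.mem_insert_iff, Sym2.eq_iff] at this
      grind
    obtain ⟨F', X', hp', -, rfl⟩ := hp.tail hcdF
    rw [hp'.eq_empty] at hF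
    have : s(a, b) ∈ (insert s(v, c) (insert s(v, d) (insert s(c, d) ∅)) : Set (Sym2 V)) :=
      hF ▸ ⟨h.ab, hab⟩
    simp only [Set.mem_insert_iff, Sym2.eq_iff, Set.mem_empty_iff_false] at this
    grind
  have hQ : IsCycleOn (insert s(v, a) (insert s(v, b) (insert s(c, d)
      ({z | z ∈ E ∧ col z = col s(a, b)} \ {s(v, c), s(v, d)}) \ {s(a, b)}))) := by
    rw [hab]
    obtain ⟨h1, h2⟩ := (hc.2 _ (hc.1 _ h.vc)).bypass (v := v) (a := c) (b := d)
      ⟨h.vc, rfl⟩ ⟨h.vd, hcd⟩ (by grind) (fun h' => hcdq h'.2)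
    refine h1.subdivide (Or.inr ⟨⟨h.ab, hab⟩, ?_⟩) h2
    simp only [Set.mem_insert_iff, Set.mem_singleton_iff, Sym2.eq_iff]
    grind
  refine hc.redistribute_four h.xy h.va h.vb h.ab h.vc h.vd h.cd ha hb hne hab.symm
    (hcd.trans hab.symm) hcdp (hab ▸ hcdq) ?_ ?_ ?_ ?_ h.vx_notMem h.vy_notMem
    (h.isCycleOn_shift hc ha hb) hQ (isCycleOn_subdivide hc h.cd fun z hz => ?_)
  · rw [Ne, Sym2.eq_iff]; grind
  · rw [Ne, Sym2.eq_iff]; grind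
  · rw [Ne, Sym2.eq_iff]; grind
  · rw [Ne, Sym2.eq_iff]; grind
  · have := h.nbr z hz
    grind

theorem recolor_of_exists (h : IsCliqueConfig E v a b c d x y) (hc : IsCycleColoring E m col)
    (ha : col s(v, a) = col s(x, y)) (hb : col s(v, b) = col s(x, y))
    (hcq : col s(v, c) ≠ col s(x, y)) (hdq : col s(v, d) ≠ col s(x, y)) :
    ∃ col', IsCycleColoring (insert s(v, x) (insert s(v, y) (E \ {s(x, y)}))) m col' := by
  have hnd := h.nodup
  have hcd : col s(v, d) = col s(v, c) := by
    obtain ⟨w, F, X, hp, hv, hne, hF⟩ := (hc.2 _ (hc.1 _ h.vc)).open_vertex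
      (v := v) (a := c) ⟨h.vc, rfl⟩
    have hw : s(v, w) ∈ {z | z ∈ E ∧ col z = col s(v, c)} := by
      rw [hF]
      exact Or.inr (Or.inl rfl)
    obtain ⟨hw1, hw2⟩ := hw
    rcases h.nbr w hw1 with rfl | rfl | rfl | rfl
    · exact absurd (hw2.symm.trans ha) hcq
    · exact absurd (hw2.symm.trans hb) hcq
    · exact absurd rfl hne
    · exact hw2
  by_cases hab : col s(a, b) = col s(v, c)
  swap
  · exact h.recolor_of_col_ne hc ha hb hcq hcd hab
  obtain ⟨hne_cd, hne_ac, hne_ad, hne_bc, hne_bd, hne_va, hne_vb⟩ :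
      c ≠ d ∧ a ≠ c ∧ a ≠ d ∧ b ≠ c ∧ b ≠ d ∧ v ≠ a ∧ v ≠ b := by grind
  have main : ∀ {a b}, IsCliqueConfig E v a b c d x y → col s(v, a) = col s(x, y) →
      col s(v, b) = col s(x, y) → col s(a, b) = col s(v, c) →
      col s(b, c) ≠ col s(v, c) → col s(a, d) ≠ col s(v, c) →
      IsCycleOn (insert s(v, a) (insert s(b, c)
        ({z | z ∈ E ∧ col z = col s(v, c)} \ {s(v, c), s(a, b)}))) →
      IsCycleOn (insert s(v, b) (insert s(a, d)
        ({z | z ∈ E ∧ col z = col s(v, c)} \ {s(v, d), s(a, b)}))) →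
      ∃ col', IsCycleColoring (insert s(v, x) (insert s(v, y) (E \ {s(x, y)}))) m col' := by
    intro a b h ha hb hab hbc had h1 h2
    by_cases hbcp : col s(b, c) = col s(x, y)
    · by_cases hadp : col s(a, d) = col s(x, y)
      · exact h.recolor_of_pentagon hc ha hb hcq hcd hab hbcp hadp
      · refine h.swap_left.swap_right.recolor_of_exchange hc hb ha hdq hcd.symm ?_ ?_ hadp ?_
        · rw [Sym2.eq_swap, hcd, hab]
        · rwa [hcd]
        · rwa [hcd, Sym2.eq_swap (a := b) (b := a)]
    · exact h.recolor_of_exchange hc ha hb hcq hcd hab hbc hbcp h1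
  rcases (hc.2 _ (hc.1 _ h.vc)).exchange (v := v) (a := a) (b := b) (c := c) (d := d)
    ⟨h.vc, rfl⟩ ⟨h.vd, hcd⟩ hne_cd ⟨h.ab, hab⟩ hne_ac hne_ad hne_bc hne_bd hne_va hne_vb
    with ⟨h1, h2, h3, h4⟩ | ⟨h1, h2, h3, h4⟩
  · exact main h ha hb hab (fun h' => h1 ⟨h.bc, h'⟩) (fun h' => h2 ⟨h.ad, h'⟩) h3 h4
  · rw [Sym2.eq_swap (a := a) (b := b)] at h3 h4
    exact main h.swap_left hb ha (by rw [Sym2.eq_swap, hab]) (fun h' => h1 ⟨h.ac, h'⟩)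
      (fun h' => h2 ⟨h.bd, h'⟩) h3 h4

/-- If `E` decomposes into `m` cycles, then so does the set obtained by subdividing the edge
`x y` by `v`. -/
theorem recolor (h : IsCliqueConfig E v a b c d x y) (hc : IsCycleColoring E m col) :
    ∃ col', IsCycleColoring (insert s(v, x) (insert s(v, y) (E \ {s(x, y)}))) m col' := by
  by_cases hv : ∃ z, s(v, z) ∈ E ∧ col s(v, z) = col s(x, y)
  swap
  · push Not at hv
    exact hc.replace h.xy h.vx_notMem h.vy_notMem (isCycleOn_subdivide hc h.xy hv)
  have hP := hc.2 _ (hc.1 _ h.xy)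
  have at_most : ∀ {a b c d}, IsCliqueConfig E v a b c d x y → col s(v, a) = col s(x, y) →
      col s(v, b) = col s(x, y) → col s(v, c) ≠ col s(x, y) := by
    intro a b c d h ha hb hc'
    have hnd := h.nodup
    obtain ⟨F, X, hp, hv, hF⟩ := hP.open_vertex_pair (v := v) (a := a) (b := b)
      ⟨h.va, ha⟩ ⟨h.vb, hb⟩ (by grind)
    have : s(v, c) ∈ insert s(v, a) (insert s(v, b) F) := hF ▸ ⟨h.vc, hc'⟩
    have hF' : s(v, c) ∉ F := fun h' => hv (hp.mem_of_mem h').1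
    simp only [Set.mem_insert_iff, Sym2.eq_iff, hF', or_false] at this
    clear hF hP hc'
    grind
  have pair : ∀ {a b c d}, IsCliqueConfig E v a b c d x y → col s(v, a) = col s(x, y) →
      col s(v, b) = col s(x, y) →
      ∃ col', IsCycleColoring (insert s(v, x) (insert s(v, y) (E \ {s(x, y)}))) m col' :=
    fun h ha hb => h.recolor_of_exists hc ha hb (at_most h ha hb) (at_most h.swap_right ha hb)
  have single : ∀ {a b c d}, IsCliqueConfig E v a b c d x y → col s(v, a) = col s(x, y) →
      ∃ col', IsCycleColoring (insert s(v, x) (insert s(v, y) (E \ {s(x, y)}))) m col' := by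
    intro a b c d h ha
    obtain ⟨w, F, X, hp, hv, hne, hF⟩ := hP.open_vertex (v := v) (a := a) ⟨h.va, ha⟩
    have hw : s(v, w) ∈ {z | z ∈ E ∧ col z = col s(x, y)} := by
      rw [hF]
      exact Or.inr (Or.inl rfl)
    obtain ⟨hw1, hw2⟩ := hw
    rcases h.nbr w hw1 with rfl | rfl | rfl | rfl
    · exact absurd rfl hne
    · exact pair h ha hw2
    · exact pair h.swap_middle ha hw2
    · exact pair h.swap_right.swap_middle ha hw2
  obtain ⟨z, hz1, hz2⟩ := hv
  rcases h.nbr z hz1 with rfl | rfl | rfl | rfl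
  · exact single h hz2
  · exact single h.swap_left hz2
  · exact single h.swap_middle.swap_left hz2
  · exact single h.swap_right.swap_middle.swap_left hz2

end IsCliqueConfig

/-- Replacing the path `x v y` by the edge `x y` keeps all degrees even. -/
theorem even_neighborSet_of_suppress {V : Type} [Fintype V] {G H : SimpleGraph V} {v x y : V}
    (hx : G.Adj v x) (hy : G.Adj v y) (hne : x ≠ y) (hxy : ¬ G.Adj x y)
    (hH : ∀ w z, H.Adj w z ↔
      s(w, z) = s(x, y) ∨ G.Adj w z ∧ s(w, z) ≠ s(v, x) ∧ s(w, z) ≠ s(v, y))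
    (hG : ∀ w, Even (G.neighborSet w).ncard) (w : V) : Even (H.neighborSet w).ncard := by
  have hvx := hx.ne
  have hvy := hy.ne
  have hadj : ∀ z, z ∈ H.neighborSet w ↔ (w = x ∧ z = y ∨ w = y ∧ z = x) ∨ G.Adj w z ∧
      ¬ (w = v ∧ z = x ∨ w = x ∧ z = v) ∧ ¬ (w = v ∧ z = y ∨ w = y ∧ z = v) := by
    intro z
    rw [SimpleGraph.mem_neighborSet, hH, Ne, Ne, Sym2.eq_iff, Sym2.eq_iff, Sym2.eq_iff]
  clear hH
  have hw := hG w
  clear hG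
  by_cases hwv : w = v
  · subst hwv
    have : H.neighborSet w = G.neighborSet w \ {x, y} := by
      ext z
      rw [hadj]
      simp only [Set.mem_sdiff, SimpleGraph.mem_neighborSet, Set.mem_insert_iff,
        Set.mem_singleton_iff]
      clear hadj hw
      grind
    have hsub : {x, y} ⊆ G.neighborSet w := by
      rintro z (rfl | rfl) <;> assumption
    rw [this, Set.ncard_sdiff hsub (Set.toFinite _), Set.ncard_pair hne]
    exact hw.tsub even_two
  by_cases hwx : w = x
  · subst hwx
    have : H.neighborSet w = insert y (G.neighborSet w \ {v}) := by
      ext z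
      rw [hadj]
      simp only [Set.mem_sdiff, SimpleGraph.mem_neighborSet, Set.mem_insert_iff,
        Set.mem_singleton_iff]
      clear hadj hw
      grind
    rwa [this, Set.ncard_exchange (s := G.neighborSet w) hxy hx.symm]
  by_cases hwy : w = y
  · subst hwy
    have : H.neighborSet w = insert x (G.neighborSet w \ {v}) := by
      ext z
      rw [hadj]
      simp only [Set.mem_sdiff, SimpleGraph.mem_neighborSet, Set.mem_insert_iff,
        Set.mem_singleton_iff]
      clear hadj hw
      grind
    rwa [this, Set.ncard_exchange (s := G.neighborSet w) (fun h => hxy h.symm) hy.symm]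
  · have : H.neighborSet w = G.neighborSet w := by
      ext z
      rw [hadj, SimpleGraph.mem_neighborSet]
      clear hadj hw
      grind
    rwa [this]

/-- In a minimum counterexample, if `v` has degree 6 with neighbourhood
`{x₁, x₂, x₃, x₄, x₅, x₆}` and `{x₁, x₂, x₃, x₄}` is a 4-clique, then `x₅x₆` is an edge. -/
theorem minCounterexample_deg_six_clique {V : Type} [Fintype V]
    (G : SimpleGraph V) (hG : IsMinCounterexample G)
    (v x₁ x₂ x₃ x₄ x₅ x₆ : V)
    (hv : (G.neighborSet v).ncard = 6)
    (hN : G.neighborSet v = {x₁, x₂, x₃, x₄, x₅, x₆})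
    (h12 : G.Adj x₁ x₂) (h13 : G.Adj x₁ x₃) (h14 : G.Adj x₁ x₄)
    (h23 : G.Adj x₂ x₃) (h24 : G.Adj x₂ x₄) (h34 : G.Adj x₃ x₄) :
    G.Adj x₅ x₆ := by
  classical
  by_contra h56
  have hadj : ∀ z, G.Adj v z ↔ z ∈ ({x₁, x₂, x₃, x₄, x₅, x₆} : Set V) := fun z => by
    rw [← hN, SimpleGraph.mem_neighborSet]
  simp only [Set.mem_insert_iff, Set.mem_singleton_iff] at hadj
  have hnd : [v, x₁, x₂, x₃, x₄, x₅, x₆].Nodup := by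
    have hself := (hadj v).not.1 (G.loopless.irrefl v)
    have h6 : [x₁, x₂, x₃, x₄, x₅, x₆].Nodup := by
      rw [← Multiset.coe_nodup, ← Multiset.toFinset_card_eq_card_iff_nodup, ← Set.ncard_coe_finset]
      convert hv using 2
      · simp [hN]
      · rfl
    simp only [List.nodup_cons, List.mem_cons, List.not_mem_nil, or_false] at h6 ⊢
    exact ⟨hself, h6⟩
  have h5 : G.Adj v x₅ := (hadj _).2 (by simp)
  have h6 : G.Adj v x₆ := (hadj _).2 (by simp)
  have hx56 : x₅ ≠ x₆ := by
    simp only [List.nodup_cons, List.mem_cons, List.not_mem_nil, or_false] at hnd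
    tauto
  have hne₁ : s(x₅, x₆) ≠ s(v, x₅) := by simp [h5.ne', h6.ne']
  have hne₂ : s(x₅, x₆) ≠ s(v, x₆) := by simp [h5.ne', h6.ne']
  have hne₃ : s(v, x₅) ≠ s(v, x₆) := by simp [h6.ne, hx56]
  set E := insert s(x₅, x₆) (G.edgeSet \ {s(v, x₅), s(v, x₆)}) with hE
  have hxy : s(x₅, x₆) ∉ G.edgeSet := h56
  have hGE : insert s(v, x₅) (insert s(v, x₆) (E \ {s(x₅, x₆)})) = G.edgeSet := by
    have h5' : s(v, x₅) ∈ G.edgeSet := h5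
    have h6' : s(v, x₆) ∈ G.edgeSet := h6
    rw [hE]
    clear_value E
    ext z
    simp only [Set.mem_insert_iff, Set.mem_sdiff, Set.mem_singleton_iff]
    grind
  set H := SimpleGraph.fromEdgeSet E with hH
  have hHE : H.edgeSet = E := by
    rw [hH, SimpleGraph.edgeSet_fromEdgeSet, sdiff_eq_left, Set.disjoint_left]
    rintro z (rfl | hz) hd
    · exact hx56 hd
    · exact G.not_isDiag_of_mem_edgeSet hz.1 hd
  have hHadj : ∀ w z, H.Adj w z ↔
      s(w, z) = s(x₅, x₆) ∨ G.Adj w z ∧ s(w, z) ≠ s(v, x₅) ∧ s(w, z) ≠ s(v, x₆) := by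
    intro w z
    rw [← SimpleGraph.mem_edgeSet, hHE, hE]
    simp
  have heven := even_neighborSet_of_suppress h5 h6 hx56 h56 hHadj hG.1.1.2
  have hlt : H.edgeSet.ncard < G.edgeSet.ncard := by
    have hsub : {s(v, x₅), s(v, x₆)} ⊆ G.edgeSet := by
      rintro z (rfl | rfl) <;> assumption
    have h1 := Set.ncard_sdiff hsub (Set.toFinite _)
    have h2 := Set.ncard_le_ncard hsub (Set.toFinite _)
    have h3 := Set.ncard_insert_le s(x₅, x₆) (G.edgeSet \ {s(v, x₅), s(v, x₆)})
    rw [Set.ncard_pair hne₃] at h1 h2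
    rw [hHE, hE]
    omega
  have hconf : IsCliqueConfig H.edgeSet v x₁ x₂ x₃ x₄ x₅ x₆ := by
    have hcl : ∀ w z, G.Adj w z → (w ≠ v ∧ z ≠ v ∨ z ≠ x₅ ∧ z ≠ x₆ ∧ w ≠ x₅ ∧ w ≠ x₆) →
        s(w, z) ∈ H.edgeSet := by
      intro w z hwz hne
      rw [SimpleGraph.mem_edgeSet, hHadj]
      refine Or.inr ⟨hwz, ?_, ?_⟩ <;>
      · rw [Ne, Sym2.eq_iff]
        clear hN hGE hHE hE hadj
        grind
    clear hN hGE hHE hE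
    refine ⟨hnd, hcl _ _ ?_ ?_, hcl _ _ ?_ ?_, hcl _ _ ?_ ?_, hcl _ _ ?_ ?_, hcl _ _ h12 ?_,
      hcl _ _ h13 ?_, hcl _ _ h14 ?_, hcl _ _ h23 ?_, hcl _ _ h24 ?_, hcl _ _ h34 ?_,
      (hHadj _ _).2 (Or.inl rfl), fun z hz => ?_⟩
    rotate_right
    · rw [SimpleGraph.mem_edgeSet, hHadj] at hz
      simp only [Ne, Sym2.eq_iff] at hz
      grind
    all_goals grind
  have hH' := hG.fulfilsHajos_of_even _ V H rfl le_rfl (fun _ => hlt) heven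
  rw [fulfilsHajos_iff_s5] at hH'
  obtain ⟨m, hm, col, hcol⟩ := hH'
  obtain ⟨col', hcol'⟩ := hconf.recolor hcol
  rw [hHE, hGE] at hcol'
  exact hG.1.2 ((fulfilsHajos_iff_s5 G).2 ⟨m, hm, col', hcol'⟩)
end
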